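/- Let n ≥ 2 and let μ be a finite positive Borel measure on S^{2n−1} which is pluriharmonic, i.e. π_{p,q}μ = 0 whenever p ≥ 1 and q ≥ 1. Then μ(E) = 0 for every Borel set E ⊆ S^{2n−1} with H^{2n−2}(E) < ∞. -/

import Mathlib

open MeasureTheory Metric Set
open scoped ENNReal NNReal

noncomputable section

instance {n : ℕ} : MeasurableSpace (EuclideanSpace ℂ (Fin n)) := borel _
instance {n : ℕ} : BorelSpace (EuclideanSpace ℂ (Fin n)) := ⟨rfl⟩

/-- The unit sphere `S^{2n−1} ⊆ ℂⁿ`. -/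
def unitSphere (n : ℕ) : Set (EuclideanSpace ℂ (Fin n)) :=
  Metric.sphere 0 1

/-- The real Laplacian (in the `2n` real variables) of `P : ℂⁿ → ℂ` at `z`, computed
with respect to the orthonormal real basis `e_j, i·e_j`. -/
def cplxLaplacian {n : ℕ} (P : EuclideanSpace ℂ (Fin n) → ℂ)
    (z : EuclideanSpace ℂ (Fin n)) : ℂ :=
  ∑ j : Fin n,
    (fderiv ℝ (fun w => fderiv ℝ P w (EuclideanSpace.single j 1)) z
        (EuclideanSpace.single j 1) +
      fderiv ℝ (fun w => fderiv ℝ P w (Complex.I • EuclideanSpace.single j 1)) z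
        (Complex.I • EuclideanSpace.single j 1))

/-- `P : ℂⁿ → ℂ` is (the extension of) an element of `H(p,q)`: smooth, harmonic in the
`2n` real variables, and `(p,q)`-homogeneous: `P(λz) = λᵖ (conj λ)^q P(z)`. -/
def MemHpq (n p q : ℕ) (P : EuclideanSpace ℂ (Fin n) → ℂ) : Prop :=
  ContDiff ℝ (⊤ : ℕ∞) P ∧ (∀ z, cplxLaplacian P z = 0) ∧
  ∀ (c : ℂ) (z : EuclideanSpace ℂ (Fin n)),
    P (c • z) = c ^ p * (starRingEnd ℂ c) ^ q * P z

/-- `π_{p,q}μ = 0` for the complex measure `μ = f·ν` on the sphere: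
`∫ conj(h) dμ = 0` for every `h ∈ H(p,q)`. -/
def projPQZero {n : ℕ} (ν : Measure (EuclideanSpace ℂ (Fin n)))
    (f : EuclideanSpace ℂ (Fin n) → ℂ) (p q : ℕ) : Prop :=
  ∀ P : EuclideanSpace ℂ (Fin n) → ℂ, MemHpq n p q P →
    ∫ z, (starRingEnd ℂ) (P z) * f z ∂ν = 0

/-- `(p,q) ∈ κ(ε) = {(x,y) ∈ (0,∞)² : 1−ε < y/x < 1/(1−ε)}`. -/
def memKappa (ε : ℝ) (p q : ℕ) : Prop :=
  0 < p ∧ 0 < q ∧ 1 - ε < (q : ℝ) / p ∧ (q : ℝ) / p < 1 / (1 - ε)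

/-- The circle orbit `𝕋·E = {e^{it} z : z ∈ E, t ∈ ℝ}`. -/
def circleOrbit {n : ℕ} (E : Set (EuclideanSpace ℂ (Fin n))) :
    Set (EuclideanSpace ℂ (Fin n)) :=
  {w | ∃ z ∈ E, ∃ t : ℝ, w = Complex.exp (t * Complex.I) • z}

open scoped Topology

noncomputable section Bpart
/-- monomial -/
def mono3 {n : ℕ} (ζ : EuclideanSpace ℂ (Fin n)) (a b j : ℕ) (x : EuclideanSpace ℂ (Fin n)) : ℂ :=
  (inner ℂ ζ x) ^ a * (inner ℂ x ζ) ^ b * (inner ℂ x x) ^ j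

def linL {n : ℕ} (ζ : EuclideanSpace ℂ (Fin n)) : EuclideanSpace ℂ (Fin n) →L[ℝ] ℂ :=
  (innerSL ℂ ζ).restrictScalars ℝ

def linLb {n : ℕ} (ζ : EuclideanSpace ℂ (Fin n)) : EuclideanSpace ℂ (Fin n) →L[ℝ] ℂ :=
  (Complex.conjCLE : ℂ →L[ℝ] ℂ).comp (linL ζ)

lemma linL_apply {n : ℕ} (ζ x : EuclideanSpace ℂ (Fin n)) : linL ζ x = inner ℂ ζ x := rfl
lemma linLb_apply {n : ℕ} (ζ x : EuclideanSpace ℂ (Fin n)) : linLb ζ x = inner ℂ x ζ := by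
  simp [linLb, linL_apply]

lemma hasFDeriv_l {n : ℕ} (ζ w : EuclideanSpace ℂ (Fin n)) :
    HasFDerivAt (fun x => inner ℂ ζ x) (linL ζ) w := (linL ζ).hasFDerivAt
lemma hasFDeriv_lb {n : ℕ} (ζ w : EuclideanSpace ℂ (Fin n)) :
    HasFDerivAt (fun x => inner ℂ x ζ) (linLb ζ) w := by
  have := (linLb ζ).hasFDerivAt (x := w)
  simpa only [← linLb_apply] using this
lemma hasFDeriv_N {n : ℕ} (w : EuclideanSpace ℂ (Fin n)) :
    HasFDerivAt (fun x => inner ℂ x x) (linL w + linLb w) w := by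
  have := (hasFDerivAt_id (𝕜 := ℝ) w).inner ℂ (hasFDerivAt_id (𝕜 := ℝ) w)
  refine this.congr_fderiv ?_
  ext v
  simp [fderivInnerCLM_apply, linL_apply, linLb_apply]

lemma hasFDeriv_mono3 {n : ℕ} (ζ w : EuclideanSpace ℂ (Fin n)) (a b j : ℕ) :
    ∃ D : EuclideanSpace ℂ (Fin n) →L[ℝ] ℂ, HasFDerivAt (mono3 ζ a b j) D w ∧
      ∀ v, D v = a * mono3 ζ (a-1) b j w * inner ℂ ζ v + b * mono3 ζ a (b-1) j w * inner ℂ v ζ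
        + j * mono3 ζ a b (j-1) w * (inner ℂ w v + inner ℂ v w) := by
  refine ⟨_, (((hasFDeriv_l ζ w).pow a).mul ((hasFDeriv_lb ζ w).pow b)).mul
    ((hasFDeriv_N w).pow j), ?_⟩
  intro v
  simp [mono3, linL_apply, linLb_apply]
  ring

lemma contDiff_mono3 {n : ℕ} (ζ : EuclideanSpace ℂ (Fin n)) (a b j : ℕ) :
    ContDiff ℝ (⊤ : ℕ∞) (mono3 ζ a b j) := by
  unfold mono3
  have h1 : ContDiff ℝ (⊤ : ℕ∞) (fun x => inner ℂ ζ x) := (linL ζ).contDiff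
  have h2 : ContDiff ℝ (⊤ : ℕ∞) (fun x : EuclideanSpace ℂ (Fin n) => inner ℂ x ζ) := by
    simp only [← linLb_apply]; exact (linLb ζ).contDiff
  have h3 : ContDiff ℝ (⊤ : ℕ∞) (fun x : EuclideanSpace ℂ (Fin n) => inner ℂ x x) :=
    contDiff_id.inner ℂ contDiff_id
  fun_prop

lemma fderiv_mono3 {n : ℕ} (ζ w v : EuclideanSpace ℂ (Fin n)) (a b j : ℕ) :
    fderiv ℝ (mono3 ζ a b j) w v = a * mono3 ζ (a-1) b j w * inner ℂ ζ v + b * mono3 ζ a (b-1) j w * inner ℂ v ζ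
        + j * mono3 ζ a b (j-1) w * (inner ℂ w v + inner ℂ v w) := by
  obtain ⟨D, h, h'⟩ := hasFDeriv_mono3 ζ w a b j
  rw [h.fderiv, h']

lemma fderiv2_mono3 {n : ℕ} (ζ w v : EuclideanSpace ℂ (Fin n)) (a b j : ℕ) :
    fderiv ℝ (fun w => fderiv ℝ (mono3 ζ a b j) w v) w v =
      a * fderiv ℝ (mono3 ζ (a-1) b j) w v * inner ℂ ζ v
      + b * fderiv ℝ (mono3 ζ a (b-1) j) w v * inner ℂ v ζ
      + j * (fderiv ℝ (mono3 ζ a b (j-1)) w v * (inner ℂ w v + inner ℂ v w)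
        + mono3 ζ a b (j-1) w * (2 * inner ℂ v v)) := by
  simp only [fderiv_mono3 ζ _ v a b j]
  have h1 := ((contDiff_mono3 ζ (a-1) b j).differentiable (by simp) w).hasFDerivAt
  have h2 := ((contDiff_mono3 ζ a (b-1) j).differentiable (by simp) w).hasFDerivAt
  have h3 := ((contDiff_mono3 ζ a b (j-1)).differentiable (by simp) w).hasFDerivAt
  have h4 := (hasFDeriv_lb v w).add (hasFDeriv_l v w)
  have := (((h1.const_mul (a:ℂ)).mul_const (inner ℂ ζ v)).add
    ((h2.const_mul (b:ℂ)).mul_const (inner ℂ v ζ))).add ((h3.const_mul (j:ℂ)).mul h4)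
  have h5 := this.fderiv
  simp only [Pi.add_def, Pi.mul_def] at h5
  erw [h5]
  simp [linL_apply, linLb_apply]
  ring

lemma lap_mono3 {n : ℕ} (ζ w : EuclideanSpace ℂ (Fin n)) (hζ : ‖ζ‖ = 1) (a b j : ℕ) :
    cplxLaplacian (mono3 ζ a b j) w = 4 * a * b * mono3 ζ (a-1) (b-1) j w
      + 4 * j * (a + b + (j - 1) + n) * mono3 ζ a b (j-1) w := by
  have key : ∀ i : Fin n, (fderiv ℝ (fun w => fderiv ℝ (mono3 ζ a b j) w (EuclideanSpace.single i 1)) w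
        (EuclideanSpace.single i 1) +
      fderiv ℝ (fun w => fderiv ℝ (mono3 ζ a b j) w (Complex.I • EuclideanSpace.single i 1)) w
        (Complex.I • EuclideanSpace.single i 1)) =
      4 * a * b * mono3 ζ (a-1) (b-1) j w * (ζ i * star (ζ i))
      + 4 * j * a * mono3 ζ (a-1) b (j-1) w * (w i * star (ζ i))
      + 4 * j * b * mono3 ζ a (b-1) (j-1) w * (ζ i * star (w i))
      + 4 * j * (j-1 : ℕ) * mono3 ζ a b (j-1-1) w * (w i * star (w i))
      + 4 * j * mono3 ζ a b (j-1) w := by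
    intro i
    rw [fderiv2_mono3, fderiv2_mono3]
    simp only [fderiv_mono3, inner_smul_left, inner_smul_right, EuclideanSpace.inner_single_right,
      EuclideanSpace.inner_single_left, Complex.conj_I, PiLp.single_apply, if_true,
      map_one, one_mul, mul_one, Complex.star_def]
    ring_nf
    simp only [Complex.I_sq]
    ring
  unfold cplxLaplacian
  rw [Finset.sum_congr rfl (fun i _ => key i)]
  simp only [Finset.sum_add_distrib, ← Finset.mul_sum]
  have e1 : ∑ i, ζ i * star (ζ i) = 1 := by
    have : inner ℂ ζ ζ = (1:ℂ) := by rw [inner_self_eq_norm_sq_to_K, hζ]; simp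
    rw [← this, EuclideanSpace.inner_eq_star_dotProduct]; rfl
  have e2 : ∑ i, w i * star (ζ i) = inner ℂ ζ w := by
    rw [EuclideanSpace.inner_eq_star_dotProduct]; rfl
  have e3 : ∑ i, ζ i * star (w i) = inner ℂ w ζ := by
    rw [EuclideanSpace.inner_eq_star_dotProduct]; rfl
  have e4 : ∑ i, w i * star (w i) = inner ℂ w w := by
    rw [EuclideanSpace.inner_eq_star_dotProduct]; rfl
  rw [e1, e2, e3, e4]
  simp only [Finset.sum_const, Finset.card_univ, Fintype.card_fin, nsmul_eq_mul]
  have f1 : (a:ℂ) * (mono3 ζ (a-1) b (j-1) w * inner ℂ ζ w) = a * mono3 ζ a b (j-1) w := by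
    cases a with
    | zero => simp
    | succ a => simp only [mono3, Nat.add_sub_cancel]; ring
  have f2 : (b:ℂ) * (mono3 ζ a (b-1) (j-1) w * inner ℂ w ζ) = b * mono3 ζ a b (j-1) w := by
    cases b with
    | zero => simp
    | succ a => simp only [mono3, Nat.add_sub_cancel]; ring
  have f3 : (j:ℂ) * (((j-1:ℕ):ℂ) * mono3 ζ a b (j-1-1) w * inner ℂ w w) =
      j * (j - 1) * mono3 ζ a b (j-1) w := by
    rcases j with _ | _ | j
    · simp
    · simp
    · simp [mono3]; ring
  linear_combination 4 * (j:ℂ) * f1 + 4 * (j:ℂ) * f2 + 4 * f3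

lemma lap_sum {n : ℕ} {ι : Type*} (s : Finset ι) (c : ι → ℂ) (F : ι → EuclideanSpace ℂ (Fin n) → ℂ)
    (hF : ∀ i, ContDiff ℝ (⊤ : ℕ∞) (F i)) (w : EuclideanSpace ℂ (Fin n)) :
    cplxLaplacian (fun x => ∑ i ∈ s, c i * F i x) w = ∑ i ∈ s, c i * cplxLaplacian (F i) w := by
  have h1 : ∀ x v, fderiv ℝ (fun x => ∑ i ∈ s, c i * F i x) x v
      = ∑ i ∈ s, c i * fderiv ℝ (F i) x v := by
    intro x v
    have := HasFDerivAt.fun_sum (u := s) (fun i _ =>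
      (((hF i).differentiable (by simp) x).hasFDerivAt).const_mul (c i))
    rw [this.fderiv]; simp
  have h2 : ∀ x v, fderiv ℝ (fun x => fderiv ℝ (fun x => ∑ i ∈ s, c i * F i x) x v) x v
      = ∑ i ∈ s, c i * fderiv ℝ (fun x => fderiv ℝ (F i) x v) x v := by
    intro x v
    simp only [h1]
    have hd : ∀ i, DifferentiableAt ℝ (fun x => fderiv ℝ (F i) x v) x := by
      intro i
      have : Differentiable ℝ (fderiv ℝ (F i)) :=
        ((hF i).fderiv_right (m := 1) (by norm_cast)).differentiable (by simp)
      exact (this x).clm_apply (by fun_prop)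
    have := HasFDerivAt.fun_sum (u := s) (fun i _ => (hd i).hasFDerivAt.const_mul (c i))
    rw [this.fderiv]; simp
  unfold cplxLaplacian
  simp only [h2]
  simp only [← Finset.sum_add_distrib, ← mul_add]
  rw [Finset.sum_comm]
  simp only [Finset.mul_sum]

end Bpart

noncomputable section B2part
def binC (n k : ℕ) : ℝ := (Nat.choose (k + (n-1)) (n-1) : ℝ)
def Iab (n k : ℕ) : ℝ := (binC n k)⁻¹

lemma binC_pos (n k : ℕ) : 0 < binC n k := by
  unfold binC; exact_mod_cast Nat.choose_pos (by omega)
lemma Iab_pos (n k : ℕ) : 0 < Iab n k := inv_pos.2 (binC_pos n k)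

lemma binC_rec (n k : ℕ) (hn : 2 ≤ n) : binC n (k+1) * (k+1) = binC n k * (k + n) := by
  obtain ⟨m, rfl⟩ : ∃ m, n = m + 1 := ⟨n-1, by omega⟩
  unfold binC
  simp only [Nat.add_sub_cancel]
  have := Nat.add_one_mul_choose_eq (k+m) k
  rw [Nat.choose_symm_add, Nat.choose_symm_of_eq_add (show k+m+1 = (k+1) + m by omega)] at this
  rw [show k + 1 + m = k+m+1 by omega]
  have h : ((k+m+1 : ℕ):ℝ) * ((k+m).choose m) = ((k+m+1).choose m) * (k+1 : ℕ) := by exact_mod_cast this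
  push_cast at h ⊢
  linarith

lemma Iab_rec (n k : ℕ) (hn : 2 ≤ n) : Iab n (k+1) * (k+n) = Iab n k * (k + 1) := by
  have := binC_rec n k hn
  have h1 := binC_pos n k
  have h2 := binC_pos n (k+1)
  unfold Iab
  field_simp
  linarith

def cof (n p q : ℕ) : ℕ → ℝ
  | 0 => 1
  | j+1 => - cof n p q j * ((p:ℝ)-j) * ((q:ℝ)-j) / ((j+1) * ((p:ℝ)+q+n-2-j))

lemma cof_rec (n p q j : ℕ) (hn : 2 ≤ n) (hj : j < q) :
    cof n p q (j+1) * ((j+1) * ((p:ℝ)+q+n-2-j)) = - cof n p q j * ((p:ℝ)-j) * ((q:ℝ)-j) := by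
  have h1 : (2:ℝ) ≤ n := by exact_mod_cast hn
  have h2 : (j:ℝ) + 1 ≤ q := by exact_mod_cast hj
  have h3 : (0:ℝ) ≤ p := by positivity
  have h4 : (0:ℝ) < (j+1) * ((p:ℝ)+q+n-2-j) := by
    apply mul_pos <;> [positivity; linarith]
  show _ / _ * _ = _
  rw [div_mul_cancel₀ _ h4.ne']

lemma cof_sum (n p q : ℕ) (hn : 2 ≤ n) (hpq : q ≤ p) (J : ℕ) (hJ : J ≤ q) :
    (∑ j ∈ Finset.range (J+1), cof n p q j * Iab n (p-j)) * (q * ((p:ℝ)+n-1)) =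
      cof n p q J * Iab n (p-J) * (((q:ℝ)-J)*((p:ℝ)+n-1-J)) := by
  induction J with
  | zero => simp [cof]
  | succ J ih =>
    rw [Finset.sum_range_succ, add_mul, ih (by omega)]
    have h := cof_rec n p q J hn (by omega)
    obtain ⟨a, rfl⟩ : ∃ a, p = a + 1 + J := ⟨p-1-J, by omega⟩
    rw [show a + 1 + J - (J+1) = a by omega, show a + 1 + J - J = a + 1 by omega]
    have hr := Iab_rec n a hn
    push_cast at h ⊢
    have h1 : (2:ℝ) ≤ n := by exact_mod_cast hn
    set X := cof n (a+1+J) q J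
    set Y := cof n (a+1+J) q (J+1)
    linear_combination Iab n a * h + X * ((q:ℝ)-J) * hr

lemma cof_sum_zero (n p q : ℕ) (hn : 2 ≤ n) (hpq : q ≤ p) (hq : 1 ≤ q) :
    (∑ j ∈ Finset.range (q+1), cof n p q j * Iab n (p-j)) = 0 := by
  have := cof_sum n p q hn hpq q le_rfl
  simp only [sub_self, zero_mul, mul_zero] at this
  rcases mul_eq_zero.1 this with h | h
  · exact h
  · exfalso
    have h1 : (2:ℝ) ≤ n := by exact_mod_cast hn
    have h2 : (1:ℝ) ≤ q := by exact_mod_cast hq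
    have h3 : (0:ℝ) ≤ p := by positivity
    have : (0:ℝ) < q * ((p:ℝ)+n-1) := by apply mul_pos <;> linarith
    linarith

lemma memHpq_zonal (n p q : ℕ) (hn : 2 ≤ n) (hpq : q ≤ p) (ζ : EuclideanSpace ℂ (Fin n)) (hζ : ‖ζ‖ = 1) :
    MemHpq n p q (fun x => ∑ j ∈ Finset.range (q+1), (cof n p q j : ℂ) * mono3 ζ (p-j) (q-j) j x) := by
  refine ⟨?_, ?_, ?_⟩
  · have := fun j => contDiff_mono3 ζ (p-j) (q-j) j
    fun_prop
  · intro z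
    rw [lap_sum _ _ _ (fun j => contDiff_mono3 ζ (p-j) (q-j) j)]
    have key : ∀ J, J ≤ q → ∑ j ∈ Finset.range (J+1), (cof n p q j : ℂ) * cplxLaplacian (mono3 ζ (p-j) (q-j) j) z
        = 4 * cof n p q J * ((p:ℂ)-J) * ((q:ℂ)-J) * mono3 ζ (p-J-1) (q-J-1) J z := by
      intro J hJ
      induction J with
      | zero => simp [cof, lap_mono3 ζ z hζ]
      | succ J ih =>
        rw [Finset.sum_range_succ, ih (by omega), lap_mono3 ζ z hζ]
        have h := cof_rec n p q J hn (by omega)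
        have h' := congrArg (fun x : ℝ => (x:ℂ)) h
        push_cast at h'
        rw [Nat.cast_sub (by omega), Nat.cast_sub (by omega)]
        rw [show p - (J+1) = p - J - 1 by omega, show q - (J+1) = q - J - 1 by omega, Nat.add_sub_cancel]
        push_cast
        linear_combination 4 * mono3 ζ (p-J-1) (q-J-1) J z * h'
    rw [key q le_rfl]; simp
  · intro c z
    rw [Finset.mul_sum]
    refine Finset.sum_congr rfl fun j hj => ?_
    have hj' : j ≤ q := by simpa [Nat.lt_succ_iff] using hj
    obtain ⟨b, rfl⟩ := Nat.exists_eq_add_of_le hj'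
    obtain ⟨a, rfl⟩ := Nat.exists_eq_add_of_le (hj'.trans hpq)
    simp only [mono3, inner_smul_left, inner_smul_right, Nat.add_sub_cancel_left]
    ring

section
variable {n : ℕ} (μ : Measure (EuclideanSpace ℂ (Fin n)))

def Pluri (μ : Measure (EuclideanSpace ℂ (Fin n))) : Prop :=
  ∀ p q : ℕ, 1 ≤ p → 1 ≤ q →
      ∀ P : EuclideanSpace ℂ (Fin n) → ℂ, MemHpq n p q P →
        ∫ z, (starRingEnd ℂ) (P z) ∂μ = 0

lemma ae_sphere {μ : Measure (EuclideanSpace ℂ (Fin n))} (hsupp : μ (unitSphere n)ᶜ = 0) :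
    ∀ᵐ ξ ∂μ, ‖ξ‖ = 1 := by
  have : ∀ᵐ ξ ∂μ, ξ ∈ unitSphere n := by
    rw [ae_iff]; exact hsupp
  filter_upwards [this] with ξ h
  simpa [unitSphere] using h

lemma integrable_cont [IsFiniteMeasure μ] (hsupp : μ (unitSphere n)ᶜ = 0)
    {F : EuclideanSpace ℂ (Fin n) → ℂ} (hF : AEStronglyMeasurable F μ) (C : ℝ) (hC : ∀ ξ, ‖ξ‖ = 1 → ‖F ξ‖ ≤ C) :
    Integrable F μ := by
  refine Integrable.of_bound hF C ?_
  filter_upwards [ae_sphere hsupp] with ξ h using hC ξ h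

lemma norm_inner_le_one {ξ ζ : EuclideanSpace ℂ (Fin n)} (h : ‖ξ‖ = 1) (h' : ‖ζ‖ = 1) :
    ‖(inner ℂ ξ ζ : ℂ)‖ ≤ 1 := by
  have := norm_inner_le_norm (𝕜 := ℂ) ξ ζ
  rw [h, h'] at this; simpa using this

theorem moments [IsFiniteMeasure μ] (hn : 2 ≤ n) (hsupp : μ (unitSphere n)ᶜ = 0) (hpl : Pluri μ)
    (ζ : EuclideanSpace ℂ (Fin n)) (hζ : ‖ζ‖ = 1) (k N : ℕ) :
    ∫ ξ, ((‖(inner ℂ ξ ζ : ℂ)‖ ^ 2 : ℝ) : ℂ) ^ N * (inner ℂ ξ ζ) ^ k ∂μ =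
      (Iab n (N+k) : ℂ) * ((binC n k : ℂ) * ∫ ξ, (inner ℂ ξ ζ) ^ k ∂μ) := by
  induction N using Nat.strong_induction_on with
  | _ q IH =>
  rcases Nat.eq_zero_or_pos q with rfl | hq
  · simp only [pow_zero, one_mul, zero_add]
    rw [← mul_assoc, ← Complex.ofReal_mul]
    rw [show Iab n k * binC n k = 1 from inv_mul_cancel₀ (binC_pos n k).ne']
    simp
  have h := hpl (k+q) q (by omega) hq _ (memHpq_zonal n (k+q) q hn (by omega) ζ hζ)
  have h2 : ∫ z, (starRingEnd ℂ) (∑ j ∈ Finset.range (q+1), (cof n (k+q) q j : ℂ) * mono3 ζ (k+q-j) (q-j) j z) ∂μ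
      = ∫ z, ∑ j ∈ Finset.range (q+1), (cof n (k+q) q j : ℂ) * (((‖(inner ℂ z ζ : ℂ)‖ ^ 2 : ℝ) : ℂ) ^ (q-j) * (inner ℂ z ζ) ^ k) ∂μ := by
    refine integral_congr_ae ?_
    filter_upwards [ae_sphere hsupp] with z hz
    rw [map_sum]
    refine Finset.sum_congr rfl fun j hj => ?_
    have hj' : j ≤ q := by simpa [Nat.lt_succ_iff] using hj
    obtain ⟨b, rfl⟩ := Nat.exists_eq_add_of_le hj'
    rw [show k + (j+b) - j = k + b by omega, show j + b - j = b by omega]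
    simp only [mono3, map_mul, map_pow, inner_conj_symm, Complex.conj_ofReal]
    rw [inner_self_eq_norm_sq_to_K, hz]
    have : ((‖(inner ℂ z ζ : ℂ)‖ ^ 2 : ℝ) : ℂ) = inner ℂ z ζ * inner ℂ ζ z := by
      rw [← inner_conj_symm ζ z, Complex.mul_conj, Complex.normSq_eq_norm_sq]
    rw [this]
    simp
    left
    ring
  rw [h2, integral_finsetSum] at h
  swap
  · intro j hj
    refine integrable_cont μ hsupp ?_ (‖(cof n (k+q) q j : ℂ)‖) ?_
    · exact Continuous.aestronglyMeasurable (by fun_prop)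
    · intro ξ hξ
      have := norm_inner_le_one hξ hζ
      rw [norm_mul, norm_mul, norm_pow, norm_pow, Complex.norm_real (‖_‖^2), norm_pow, norm_norm]
      refine mul_le_of_le_one_right (norm_nonneg _) ?_
      refine mul_le_one₀ (pow_le_one₀ (by positivity) (pow_le_one₀ (norm_nonneg _) this)) (by positivity) (pow_le_one₀ (norm_nonneg _) this)
  simp only [integral_const_mul] at h
  rw [Finset.sum_range_succ'] at h
  have hz := cof_sum_zero n (k+q) q hn (by omega) hq
  rw [Finset.sum_range_succ'] at hz
  have hz' := congrArg (fun x : ℝ => (x:ℂ)) hz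
  push_cast at hz'
  simp only [cof, Nat.sub_zero, Complex.ofReal_one, one_mul] at h hz'
  have h3 : ∑ i ∈ Finset.range q, (cof n (k+q) q (i+1) : ℂ) * ∫ ξ, ((‖(inner ℂ ξ ζ : ℂ)‖ ^ 2 : ℝ) : ℂ) ^ (q-(i+1)) * (inner ℂ ξ ζ) ^ k ∂μ
      = (∑ i ∈ Finset.range q, (cof n (k+q) q (i+1) : ℂ) * Iab n (k+q-(i+1))) * ((binC n k : ℂ) * ∫ ξ, (inner ℂ ξ ζ) ^ k ∂μ) := by
    rw [Finset.sum_mul]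
    refine Finset.sum_congr rfl fun j hj => ?_
    have hj := Finset.mem_range.1 hj
    rw [IH (q-(j+1)) (by omega), show q - (j+1) + k = k + q - (j+1) by omega]
    ring
  simp only [cof] at h3
  rw [h3] at h
  rw [add_comm q k]
  linear_combination h - ((binC n k : ℂ) * ∫ ξ, (inner ℂ ξ ζ) ^ k ∂μ) * hz'
end

end B2part

noncomputable section Apart
theorem harnack0 {f : ℂ → ℂ} (hd : DifferentiableOn ℂ f (ball 0 1))
    (hp : ∀ z ∈ ball (0:ℂ) 1, 0 ≤ (f z).re) {z : ℂ} (hz : z ∈ ball (0:ℂ) 1) :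
    (f z).re * (1 - ‖z‖) ≤ (f 0).re * (1 + ‖z‖) ∧
    (f 0).re * (1 - ‖z‖) ≤ (f z).re * (1 + ‖z‖) := by
  have key : ∀ δ : ℝ, 0 < δ → ((f z).re + δ) * (1 - ‖z‖) ≤ ((f 0).re + δ) * (1 + ‖z‖) ∧
    ((f 0).re + δ) * (1 - ‖z‖) ≤ ((f z).re + δ) * (1 + ‖z‖) := by
    intro δ hδ
    set A : ℝ := (f 0).re + δ with hA
    have h0 : (0:ℂ) ∈ ball (0:ℂ) 1 := by simp
    have hApos : 0 < A := by have := hp 0 h0; linarith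
    let G : ℂ → ℂ := fun z => f z - Complex.I * (f 0).im + δ
    have hGre : ∀ z, (G z).re = (f z).re + δ := by intro z; simp [G]
    have hG0 : G 0 = A := by
      apply Complex.ext <;> simp [G, hA]
    have hGd : DifferentiableOn ℂ G (ball 0 1) := (hd.sub_const _).add_const _
    have hne : ∀ z ∈ ball (0:ℂ) 1, G z + A ≠ 0 := by
      intro z hz h
      have := congrArg Complex.re h
      have h2 := hp z hz
      simp [hGre] at this
      linarith
    let φ : ℂ → ℂ := fun z => (G z - A) / (G z + A)
    have hφd : DifferentiableOn ℂ φ (ball 0 1) :=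
      (hGd.sub_const _).div (hGd.add_const _) hne
    have hφ0 : φ 0 = 0 := by simp [φ, hG0]
    have hmaps : MapsTo φ (ball 0 1) (closedBall 0 1) := by
      intro z hz
      simp only [mem_closedBall, dist_zero_right, φ, norm_div]
      rw [div_le_one (norm_pos_iff.2 (hne z hz))]
      rw [← abs_of_nonneg (norm_nonneg (G z - A)), ← abs_of_nonneg (norm_nonneg (G z + A)),
        ← sq_le_sq, ← Complex.normSq_eq_norm_sq, ← Complex.normSq_eq_norm_sq]
      have h2 := hp z hz
      have h3 : 0 ≤ (G z).re := by rw [hGre]; linarith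
      simp only [Complex.normSq_apply, Complex.sub_re, Complex.add_re, Complex.sub_im,
        Complex.add_im, Complex.ofReal_re, Complex.ofReal_im]
      nlinarith [mul_nonneg hApos.le h3]
    have hs := Complex.norm_le_norm_of_mapsTo_ball hφd hmaps hφ0 (by simpa using hz)
    simp only [φ, norm_div] at hs
    rw [div_le_iff₀ (norm_pos_iff.2 (hne z hz))] at hs
    have hz1 : ‖z‖ < 1 := by simpa using hz
    have hX : 0 ≤ (G z).re := by rw [hGre]; linarith [hp z hz]
    have hs2 : ‖G z - A‖ ^ 2 ≤ ‖z‖ ^ 2 * ‖G z + A‖ ^ 2 := by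
      rw [← mul_pow]; gcongr
    have e1 : ‖G z - A‖ ^ 2 = ((G z).re - A) ^ 2 + (G z).im ^ 2 := by
      rw [← Complex.normSq_eq_norm_sq, Complex.normSq_apply]; simp; ring
    have e2 : ‖G z + A‖ ^ 2 = ((G z).re + A) ^ 2 + (G z).im ^ 2 := by
      rw [← Complex.normSq_eq_norm_sq, Complex.normSq_apply]; simp; ring
    rw [e1, e2] at hs2
    have hs3 : ((G z).re - A) ^ 2 ≤ (‖z‖ * ((G z).re + A)) ^ 2 := by
      have : ‖z‖ ^ 2 * ((G z).im * (G z).im) ≤ 1 * ((G z).im * (G z).im) := by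
        apply mul_le_mul_of_nonneg_right _ (mul_self_nonneg _)
        nlinarith [norm_nonneg z]
      nlinarith
    have hs4 := abs_le_of_sq_le_sq' hs3 (by positivity)
    rw [← hGre]
    constructor <;> nlinarith [hs4.1, hs4.2]
  constructor
  · have h1 : Filter.Tendsto (fun δ : ℝ => ((f z).re + δ) * (1 - ‖z‖)) (nhdsWithin 0 (Ioi 0))
      (nhds (((f z).re + 0) * (1 - ‖z‖))) :=
      (Continuous.tendsto (by fun_prop) 0).mono_left nhdsWithin_le_nhds
    have h2 : Filter.Tendsto (fun δ : ℝ => ((f 0).re + δ) * (1 + ‖z‖)) (nhdsWithin 0 (Ioi 0))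
      (nhds (((f 0).re + 0) * (1 + ‖z‖))) :=
      (Continuous.tendsto (by fun_prop) 0).mono_left nhdsWithin_le_nhds
    simpa using le_of_tendsto_of_tendsto h1 h2
      (by filter_upwards [self_mem_nhdsWithin] with δ hδ using (key δ hδ).1)
  · have h1 : Filter.Tendsto (fun δ : ℝ => ((f 0).re + δ) * (1 - ‖z‖)) (nhdsWithin 0 (Ioi 0))
      (nhds (((f 0).re + 0) * (1 - ‖z‖))) :=
      (Continuous.tendsto (by fun_prop) 0).mono_left nhdsWithin_le_nhds
    have h2 : Filter.Tendsto (fun δ : ℝ => ((f z).re + δ) * (1 + ‖z‖)) (nhdsWithin 0 (Ioi 0))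
      (nhds (((f z).re + 0) * (1 + ‖z‖))) :=
      (Continuous.tendsto (by fun_prop) 0).mono_left nhdsWithin_le_nhds
    simpa using le_of_tendsto_of_tendsto h1 h2
      (by filter_upwards [self_mem_nhdsWithin] with δ hδ using (key δ hδ).2)

theorem normSq_identity (z w : ℂ) :
    ‖1 - (starRingEnd ℂ) w * z‖ ^ 2 - ‖z - w‖ ^ 2 = (1 - ‖z‖ ^ 2) * (1 - ‖w‖ ^ 2) := by
  simp only [← Complex.normSq_eq_norm_sq, Complex.normSq_apply, Complex.sub_re, Complex.sub_im,
    Complex.mul_re, Complex.mul_im, Complex.conj_re, Complex.conj_im, Complex.one_re,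
    Complex.one_im]
  ring

/-- Two-point Harnack inequality on the disc. -/
theorem harnack2 {f : ℂ → ℂ} (hd : DifferentiableOn ℂ f (ball 0 1))
    (hp : ∀ z ∈ ball (0:ℂ) 1, 0 ≤ (f z).re) {z w : ℂ} (hz : ‖z‖ < 1) (hw : ‖w‖ < 1) :
    (f z).re * (‖1 - (starRingEnd ℂ) w * z‖ - ‖z - w‖) ≤
      (f w).re * (‖1 - (starRingEnd ℂ) w * z‖ + ‖z - w‖) := by
  have hden : ∀ v : ℂ, ‖v‖ < 1 → ∀ w : ℂ, ‖w‖ < 1 → 1 + (starRingEnd ℂ) w * v ≠ 0 := by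
    intro v hv w hw h
    have : ‖(starRingEnd ℂ) w * v‖ = 1 := by
      have : (starRingEnd ℂ) w * v = -1 := by linear_combination h
      rw [this]; simp
    rw [norm_mul, RCLike.norm_conj] at this
    nlinarith [norm_nonneg v, norm_nonneg w]
  let ψ : ℂ → ℂ := fun v => (v + w) / (1 + (starRingEnd ℂ) w * v)
  have hψd : DifferentiableOn ℂ ψ (ball 0 1) := by
    apply DifferentiableOn.div (by fun_prop) (by fun_prop)
    intro v hv; exact hden v (by simpa using hv) w hw
  have hψm : MapsTo ψ (ball 0 1) (ball 0 1) := by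
    intro v hv
    have hv1 : ‖v‖ < 1 := by simpa using hv
    simp only [mem_ball, dist_zero_right, ψ, norm_div]
    have hpos := norm_pos_iff.2 (hden v hv1 w hw)
    rw [div_lt_one hpos]
    have := normSq_identity v (-w)
    simp only [map_neg, neg_mul, sub_neg_eq_add, norm_neg] at this
    have h1 : 0 < (1 - ‖v‖ ^ 2) * (1 - ‖w‖ ^ 2) := by
      apply mul_pos <;> nlinarith [norm_nonneg v, norm_nonneg w]
    exact lt_of_pow_lt_pow_left₀ 2 hpos.le (by linarith)
  have hne : 1 - (starRingEnd ℂ) w * z ≠ 0 := by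
    have := hden z hz (-w) (by simpa using hw)
    simpa [sub_eq_add_neg] using this
  have hpos := norm_pos_iff.2 hne
  let v : ℂ := (z - w) / (1 - (starRingEnd ℂ) w * z)
  have hv : ‖v‖ < 1 := by
    simp only [v, norm_div]
    rw [div_lt_one hpos]
    have := normSq_identity z w
    have h1 : 0 < (1 - ‖z‖ ^ 2) * (1 - ‖w‖ ^ 2) := by
      apply mul_pos <;> nlinarith [norm_nonneg z, norm_nonneg w]
    exact lt_of_pow_lt_pow_left₀ 2 hpos.le (by linarith)
  have hww : 1 - (starRingEnd ℂ) w * w ≠ 0 := by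
    have := hden w hw (-w) (by simpa using hw)
    simpa [sub_eq_add_neg] using this
  have hψv : ψ v = z := by
    simp only [ψ]
    rw [div_eq_iff (hden v hv w hw)]
    have hvD : v * (1 - (starRingEnd ℂ) w * z) = z - w := div_mul_cancel₀ _ hne
    apply mul_right_cancel₀ hne
    linear_combination (1 - z * (starRingEnd ℂ) w) * hvD
  have := (harnack0 (f := f ∘ ψ) (hd.comp hψd hψm) (fun x hx => hp _ (hψm hx))
    (z := v) (by simpa using hv)).1
  simp only [Function.comp, hψv] at this
  have hψ0 : ψ 0 = w := by simp [ψ]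
  rw [hψ0] at this
  have hvn : ‖v‖ * ‖1 - (starRingEnd ℂ) w * z‖ = ‖z - w‖ := by
    simp only [v, norm_div]; exact div_mul_cancel₀ _ hpos.ne'
  have h2 := mul_le_mul_of_nonneg_right this hpos.le
  calc _ = (f z).re * (1 - ‖v‖) * ‖1 - (starRingEnd ℂ) w * z‖ := by rw [← hvn]; ring
    _ ≤ _ := h2
    _ = _ := by rw [← hvn]; ring

theorem harnack4 {f : ℂ → ℂ} (hd : DifferentiableOn ℂ f (ball 0 1))
    (hp : ∀ z ∈ ball (0:ℂ) 1, 0 ≤ (f z).re) {z w : ℂ} (hz : ‖z‖ < 1) (hw : ‖w‖ < 1) :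
    (f z).re * ((1 - ‖z‖ ^ 2) * (1 - ‖w‖ ^ 2)) ≤
      (f w).re * (4 * ‖1 - (starRingEnd ℂ) w * z‖ ^ 2) := by
  have h := harnack2 hd hp hz hw
  have hi := normSq_identity z w
  have h1 : 0 ≤ (1 - ‖z‖ ^ 2) * (1 - ‖w‖ ^ 2) := by
    apply mul_nonneg <;> nlinarith [norm_nonneg z, norm_nonneg w]
  set D := ‖1 - (starRingEnd ℂ) w * z‖
  set d := ‖z - w‖
  have hD : 0 ≤ D := norm_nonneg _
  have hd0 : 0 ≤ d := norm_nonneg _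
  have hdD : d ≤ D := le_of_sq_le_sq (by linarith) hD
  have hw0 := hp w (by simpa using hw)
  have h2 := mul_le_mul_of_nonneg_right h (add_nonneg hD hd0)
  calc _ = (f z).re * (D - d) * (D + d) := by rw [← hi]; ring
    _ ≤ _ := h2
    _ = (f w).re * (D + d) ^ 2 := by ring
    _ ≤ _ := by
      apply mul_le_mul_of_nonneg_left _ hw0
      nlinarith

end Apart

noncomputable section Cpart
lemma hasSum_cg {f g : ℕ → ℂ} {a b : ℂ} (h : HasSum f a) (hf : ∀ k, g k = f k) (ha : b = a) :
    HasSum g b := by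
  rw [ha, show g = f from funext hf]; exact h

def fF {n : ℕ} (μ : Measure (EuclideanSpace ℂ (Fin n))) (z : EuclideanSpace ℂ (Fin n)) : ℂ :=
  ∫ ξ, (2 / (1 - inner ℂ ξ z) ^ n - 1) ∂μ

lemma meas_inner {n : ℕ} (z : EuclideanSpace ℂ (Fin n)) :
    Measurable (fun ξ : EuclideanSpace ℂ (Fin n) => (inner ℂ ξ z : ℂ)) :=
  Continuous.measurable (by fun_prop)

lemma one_sub_inner_ge {n : ℕ} {ξ z : EuclideanSpace ℂ (Fin n)} (h : ‖ξ‖ = 1) :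
    1 - ‖z‖ ≤ ‖1 - (inner ℂ ξ z : ℂ)‖ := by
  have h1 := norm_inner_le_norm (𝕜 := ℂ) ξ z
  have h2 := norm_sub_norm_le (1:ℂ) (inner ℂ ξ z)
  rw [h, one_mul] at h1
  simp at h2
  linarith

lemma fF_differentiableAt {n : ℕ} (μ : Measure (EuclideanSpace ℂ (Fin n))) [IsFiniteMeasure μ]
    (hsupp : μ (unitSphere n)ᶜ = 0) {z : EuclideanSpace ℂ (Fin n)} (hz : ‖z‖ < 1) :
    DifferentiableAt ℂ (fF μ) z := by
  set R := (1 + ‖z‖)/2 with hR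
  have hR1 : R < 1 := by rw [hR]; linarith
  have hzR : ‖z‖ < R := by rw [hR]; linarith
  have hd : ∀ ξ : EuclideanSpace ℂ (Fin n), ‖ξ‖ = 1 → ∀ x ∈ ball (0 : EuclideanSpace ℂ (Fin n)) R,
      HasFDerivAt (fun x => 2 / (1 - inner ℂ ξ x) ^ n - 1) 
        ((2 * n * (1 - inner ℂ ξ x : ℂ) ^ (n-1) / ((1 - inner ℂ ξ x) ^ n) ^ 2) • innerSL ℂ ξ) x := by
    intro ξ hξ x hx
    have h1 : HasFDerivAt (fun x => (inner ℂ ξ x : ℂ)) (innerSL ℂ ξ) x := (innerSL ℂ ξ).hasFDerivAt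
    have hx' : ‖x‖ < R := by simpa using hx
    have hne : (1 - inner ℂ ξ x : ℂ) ≠ 0 := by
      rw [← norm_pos_iff]
      have := one_sub_inner_ge (z := x) hξ
      linarith
    have h2 : HasDerivAt (fun w : ℂ => 2 / (1 - w) ^ n - 1) (2 * n * (1 - inner ℂ ξ x : ℂ) ^ (n-1) / ((1 - inner ℂ ξ x) ^ n) ^ 2) (inner ℂ ξ x) := by
      have h3 := ((hasDerivAt_const (inner ℂ ξ x) (2:ℂ)).div (((hasDerivAt_id (inner ℂ ξ x : ℂ)).const_sub 1).pow n) (pow_ne_zero n hne)).sub_const 1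
      refine h3.congr_deriv ?_
      simp
      ring
    exact h2.comp_hasFDerivAt x h1
  have hb : ∀ ξ : EuclideanSpace ℂ (Fin n), ‖ξ‖ = 1 → ∀ x ∈ ball (0 : EuclideanSpace ℂ (Fin n)) R,
      ‖(2 * n * (1 - inner ℂ ξ x : ℂ) ^ (n-1) / ((1 - inner ℂ ξ x) ^ n) ^ 2) • innerSL ℂ ξ‖ ≤ 2 * n * 2 ^ (n-1) / ((1-R)^n)^2 := by
    intro ξ hξ x hx
    have hx' : ‖x‖ < R := by simpa using hx
    have h1 := one_sub_inner_ge (z := x) hξ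
    have h3 : ‖1 - (inner ℂ ξ x : ℂ)‖ ≤ 2 := by
      have h1 := norm_inner_le_norm (𝕜 := ℂ) ξ x
      have h2 := norm_sub_le (1:ℂ) (inner ℂ ξ x)
      rw [hξ, one_mul] at h1
      simp at h2
      linarith
    rw [norm_smul, innerSL_apply_norm, hξ, mul_one, norm_div, norm_mul, norm_mul, norm_pow, norm_pow, norm_pow]
    simp only [Complex.norm_ofNat, Complex.norm_natCast]
    have : 0 < 1 - R := by linarith
    gcongr
    linarith
  have := hasFDerivAt_integral_of_dominated_of_fderiv_le (𝕜 := ℂ) (μ := μ) (s := ball 0 R) (x₀ := z)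
    (F := fun x ξ => 2 / (1 - inner ℂ ξ x) ^ n - 1)
    (F' := fun x ξ => (2 * n * (1 - inner ℂ ξ x : ℂ) ^ (n-1) / ((1 - inner ℂ ξ x) ^ n) ^ 2) • innerSL ℂ ξ)
    (bound := fun _ => 2 * n * 2 ^ (n-1) / ((1-R)^n)^2)
    (isOpen_ball.mem_nhds (by simpa using hzR)) ?_ ?_ ?_ ?_ (integrable_const _) ?_
  · exact this.differentiableAt
  · refine Filter.Eventually.of_forall fun x => Measurable.aestronglyMeasurable ?_
    have := meas_inner x
    fun_prop
  · refine integrable_cont μ hsupp ?_ (2 / (1-R)^n + 1) ?_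
    · have := meas_inner z
      exact Measurable.aestronglyMeasurable (by fun_prop)
    · intro ξ hξ
      have h1 := one_sub_inner_ge (z := z) hξ
      refine (norm_sub_le _ _).trans ?_
      rw [norm_div, norm_pow]
      simp only [Complex.norm_ofNat, norm_one]
      have : 0 < 1 - R := by linarith
      gcongr
      linarith
  · refine AEStronglyMeasurable.fun_smul ?_ ?_
    · have := meas_inner z
      exact Measurable.aestronglyMeasurable (by fun_prop)
    · exact (innerSL ℂ).continuous.aestronglyMeasurable
  · filter_upwards [ae_sphere hsupp] with ξ hξ using hb ξ hξ
  · filter_upwards [ae_sphere hsupp] with ξ hξ using hd ξ hξ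

def epsk (k : ℕ) : ℝ := if k = 0 then 1 else 2
lemma epsk_nonneg (k : ℕ) : 0 ≤ epsk k := by unfold epsk; split_ifs <;> norm_num
lemma epsk_le (k : ℕ) : epsk k ≤ 2 := by unfold epsk; split_ifs <;> norm_num

lemma hasSum_eps_geom {w : ℂ} (hw : ‖w‖ < 1) :
    HasSum (fun k => (epsk k : ℂ) * w ^ k) ((1 + w)/(1-w)) := by
  have h := (hasSum_geometric_of_norm_lt_one hw).mul_left 2
  have h2 := h.sub (hasSum_ite_eq 0 (1:ℂ))
  have hne : 1 - w ≠ 0 := by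
    rw [sub_ne_zero]; rintro rfl; simp at hw
  refine hasSum_cg h2 ?_ ?_
  · intro k; unfold epsk; split_ifs with h
    · subst h; norm_num
    · norm_num
  · field_simp; ring

lemma hasSum_eps_bin {n : ℕ} (hn : 2 ≤ n) {w : ℂ} (hw : ‖w‖ < 1) :
    HasSum (fun k => (epsk k : ℂ) * (binC n k * w ^ k)) (2 / (1-w)^n - 1) := by
  have h := (hasSum_choose_mul_geometric_of_norm_lt_one (n-1) hw).mul_left 2
  have h2 := h.sub (hasSum_ite_eq 0 (1:ℂ))
  rw [show n - 1 + 1 = n by omega] at h2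
  refine hasSum_cg h2 ?_ ?_
  · intro k; unfold epsk binC; split_ifs with h
    · subst h; norm_num
    · norm_num
  · ring

lemma summable_bin (n : ℕ) {r : ℝ} (h0 : 0 ≤ r) (h1 : r < 1) : Summable (fun k => binC n k * r ^ k) := 
  summable_choose_mul_geometric_of_norm_lt_one (n-1) (by rwa [Real.norm_of_nonneg h0])

/-- coefficient of the slice -/
def bk {n : ℕ} (μ : Measure (EuclideanSpace ℂ (Fin n))) (ζ : EuclideanSpace ℂ (Fin n)) (k : ℕ) : ℂ :=
  (epsk k : ℂ) * (binC n k * ∫ ξ, (inner ℂ ξ ζ) ^ k ∂μ)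

section
variable {n : ℕ} (hn : 2 ≤ n) (μ : Measure (EuclideanSpace ℂ (Fin n))) [IsFiniteMeasure μ]
  (hsupp : μ (unitSphere n)ᶜ = 0) (ζ : EuclideanSpace ℂ (Fin n)) (hζ : ‖ζ‖ = 1)
include hsupp hζ

lemma norm_bk_le (k : ℕ) : ‖bk μ ζ k‖ ≤ 2 * (binC n k * μ.real univ) := by
  unfold bk
  rw [norm_mul, norm_mul, Complex.norm_real, Complex.norm_real, Real.norm_of_nonneg (epsk_nonneg k),
    Real.norm_of_nonneg (binC_pos n k).le]
  have : ‖∫ ξ, (inner ℂ ξ ζ : ℂ) ^ k ∂μ‖ ≤ 1 * μ.real univ := by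
    refine norm_integral_le_of_norm_le_const ?_
    filter_upwards [ae_sphere hsupp] with ξ hξ
    rw [norm_pow]
    exact pow_le_one₀ (norm_nonneg _) (norm_inner_le_one hξ hζ)
  have h2 := epsk_le k
  have h3 := epsk_nonneg k
  have h4 := (binC_pos n k).le
  rw [one_mul] at this
  gcongr

lemma summable_bk {r : ℝ} (h0 : 0 ≤ r) (h1 : r < 1) : Summable (fun k => ‖bk μ ζ k‖ * r ^ k) := by
  refine Summable.of_nonneg_of_le (fun k => by positivity) (fun k => ?_)
    ((summable_bin n h0 h1).mul_left (2 * μ.real univ))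
  calc ‖bk μ ζ k‖ * r ^ k ≤ (2 * (binC n k * μ.real univ)) * r ^ k := by
        gcongr; exact norm_bk_le μ hsupp ζ hζ k
    _ = _ := by ring

include hn
lemma hasSum_fF {r : ℝ} (h0 : 0 ≤ r) (h1 : r < 1) :
    HasSum (fun k => bk μ ζ k * (r:ℂ) ^ k) (fF μ ((r:ℂ) • ζ)) := by
  have := hasSum_integral_of_dominated_convergence (μ := μ)
    (F := fun (k:ℕ) ξ => (epsk k : ℂ) * (binC n k * (inner ℂ ξ ((r:ℂ) • ζ)) ^ k))
    (f := fun ξ => 2 / (1 - inner ℂ ξ ((r:ℂ) • ζ)) ^ n - 1)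
    (fun k _ => 2 * (binC n k * r ^ k)) ?_ ?_ ?_ ?_ ?_
  · refine hasSum_cg this ?_ rfl
    intro k
    simp only [inner_smul_right, mul_pow, integral_const_mul, bk]
    ring
  · intro k
    exact Continuous.aestronglyMeasurable (by fun_prop)
  · intro k
    filter_upwards [ae_sphere hsupp] with ξ hξ
    rw [norm_mul, norm_mul, Complex.norm_real, Complex.norm_real, Real.norm_of_nonneg (epsk_nonneg k),
      Real.norm_of_nonneg (binC_pos n k).le, norm_pow, inner_smul_right, norm_mul, Complex.norm_real, Real.norm_of_nonneg h0]
    have := norm_inner_le_one hξ hζ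
    have h2 := epsk_le k
    have h3 := epsk_nonneg k
    have h4 := (binC_pos n k).le
    gcongr
    exact mul_le_of_le_one_right h0 this
  · exact Filter.Eventually.of_forall fun _ => (summable_bin n h0 h1).mul_left 2
  · exact integrable_const _
  · filter_upwards [ae_sphere hsupp] with ξ hξ
    apply hasSum_eps_bin hn
    rw [inner_smul_right, norm_mul, Complex.norm_real, Real.norm_of_nonneg h0]
    exact (mul_le_of_le_one_right h0 (norm_inner_le_one hξ hζ)).trans_lt h1

lemma hasSum_G (hpl : Pluri μ) {r : ℝ} (h0 : 0 ≤ r) (h1 : r < 1) (N : ℕ) :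
    HasSum (fun k => bk μ ζ k * (r:ℂ) ^ k * (Iab n (N+k) : ℂ))
      (∫ ξ, ((‖(inner ℂ ξ ζ : ℂ)‖ ^ 2 : ℝ) : ℂ) ^ N * ((1 + r * inner ℂ ξ ζ) / (1 - r * inner ℂ ξ ζ)) ∂μ) := by
  have := hasSum_integral_of_dominated_convergence (μ := μ)
    (F := fun (k:ℕ) ξ => ((epsk k : ℂ) * (r:ℂ)^k) * ( ((‖(inner ℂ ξ ζ : ℂ)‖ ^ 2 : ℝ) : ℂ) ^ N * (inner ℂ ξ ζ) ^ k))
    (f := fun ξ => ((‖(inner ℂ ξ ζ : ℂ)‖ ^ 2 : ℝ) : ℂ) ^ N * ((1 + r * inner ℂ ξ ζ) / (1 - r * inner ℂ ξ ζ)))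
    (fun k _ => 2 * r ^ k) ?_ ?_ ?_ ?_ ?_
  · refine hasSum_cg this ?_ rfl
    intro k
    simp only [integral_const_mul, moments μ hn hsupp hpl ζ hζ, bk]
    ring
  · intro k
    exact Continuous.aestronglyMeasurable (by fun_prop)
  · intro k
    filter_upwards [ae_sphere hsupp] with ξ hξ
    have := norm_inner_le_one hξ hζ
    have h2 := epsk_le k
    have h3 := epsk_nonneg k
    rw [norm_mul, norm_mul, norm_mul, Complex.norm_real, Real.norm_of_nonneg (epsk_nonneg k),
      norm_pow, norm_pow, norm_pow, Complex.norm_real, Complex.norm_real, Real.norm_of_nonneg h0, Real.norm_of_nonneg (by positivity)]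
    have h5 : (‖(inner ℂ ξ ζ:ℂ)‖ ^ 2) ^ N * ‖(inner ℂ ξ ζ:ℂ)‖ ^ k ≤ 1 :=
      mul_le_one₀ (pow_le_one₀ (by positivity) (pow_le_one₀ (norm_nonneg _) this)) (by positivity) (pow_le_one₀ (norm_nonneg _) this)
    calc _ ≤ epsk k * r ^ k * 1 := by gcongr
      _ ≤ _ := by rw [mul_one]; gcongr
  · exact Filter.Eventually.of_forall fun _ => (summable_geometric_of_lt_one h0 h1).mul_left 2
  · exact integrable_const _
  · filter_upwards [ae_sphere hsupp] with ξ hξ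
    have hw : ‖(r:ℂ) * inner ℂ ξ ζ‖ < 1 := by
      rw [norm_mul, Complex.norm_real, Real.norm_of_nonneg h0]
      exact (mul_le_of_le_one_right h0 (norm_inner_le_one hξ hζ)).trans_lt h1
    have := (hasSum_eps_geom hw).mul_left (((‖(inner ℂ ξ ζ : ℂ)‖ ^ 2 : ℝ) : ℂ) ^ N)
    refine hasSum_cg this ?_ rfl
    intro k; ring
end

end Cpart

noncomputable section C2part
def wgt (n N : ℕ) (x : ℝ) : ℝ := ((n:ℝ)-1) * (x ^ N * (1-x)^(n-2))

lemma wgt_int (n N : ℕ) (hn : 2 ≤ n) : ∫ x in (0:ℝ)..1, wgt n N x = Iab n N := by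
  induction N with
  | zero =>
    unfold wgt
    rw [intervalIntegral.integral_const_mul]
    simp only [pow_zero, one_mul]
    rw [intervalIntegral.integral_comp_sub_left (fun x => x ^ (n-2)) 1, integral_pow]
    obtain ⟨m, rfl⟩ := Nat.exists_eq_add_of_le hn
    simp [Iab, binC]
    field_simp
    ring_nf
  | succ N ih =>
    obtain ⟨m, rfl⟩ := Nat.exists_eq_add_of_le hn
    have hd : ∀ x ∈ uIcc (0:ℝ) 1, HasDerivAt (fun x : ℝ => x^(N+1) * (1-x)^(m+1))
        ((N+1) * (x^N * (1-x)^(m+1)) - (m+1) * (x^(N+1) * (1-x)^m)) x := by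
      intro x _
      have h1 := (hasDerivAt_id x).pow (N+1)
      have h2 := ((hasDerivAt_id x).const_sub 1).pow (m+1)
      refine (h1.mul h2).congr_deriv ?_
      simp
      ring
    have h := intervalIntegral.integral_eq_sub_of_hasDerivAt hd
      (Continuous.intervalIntegrable (by fun_prop) _ _)
    have e : ∀ x : ℝ, ((N+1) * (x^N * (1-x)^(m+1)) - (m+1) * (x^(N+1) * (1-x)^m)) * (m+1)
       = (N+1) * wgt (2+m) N x - ((N:ℝ) + (2+m)) * wgt (2+m) (N+1) x := by
      intro x; simp [wgt]; ring
    have h2 : ∫ x in (0:ℝ)..1, ((N+1) * (x^N * (1-x)^(m+1)) - (m+1) * (x^(N+1) * (1-x)^m)) * ((m:ℝ)+1) = 0 := by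
      rw [intervalIntegral.integral_mul_const, h]; simp
    simp only [e] at h2
    have hc : ∀ N, Continuous (wgt (2+m) N) := by intro N; unfold wgt; fun_prop
    rw [intervalIntegral.integral_sub, intervalIntegral.integral_const_mul, intervalIntegral.integral_const_mul, ih] at h2
    · have h3 := Iab_rec (2+m) N hn
      push_cast at h3
      have h4 : (0:ℝ) < (N:ℝ) + (2+m) := by positivity
      have : ((N:ℝ) + (2+m)) * (∫ x in (0:ℝ)..1, wgt (2+m) (N+1) x) = ((N:ℝ) + (2+m)) * Iab (2+m) (N+1) := by linarith
      exact mul_left_cancel₀ h4.ne' this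
    · exact ((hc N).const_mul _).intervalIntegrable _ _
    · exact ((hc _).const_mul _).intervalIntegrable _ _

lemma Iab_le_one (n k : ℕ) : Iab n k ≤ 1 := by
  unfold Iab binC
  apply inv_le_one_of_one_le₀
  exact_mod_cast Nat.choose_pos (by omega)

lemma Iab_anti (n k : ℕ) (hn : 2 ≤ n) : Iab n (k+1) ≤ Iab n k := by
  have h := Iab_rec n k hn
  have h1 : (2:ℝ) ≤ n := by exact_mod_cast hn
  have h2 := Iab_pos n k
  have h3 := Iab_pos n (k+1)
  have h4 : (0:ℝ) ≤ k := by positivity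
  have : Iab n (k+1) * (k+n) ≤ Iab n k * (k+n) := by rw [h]; gcongr; linarith
  exact le_of_mul_le_mul_right this (by linarith)

lemma Iab_anti' (n N k : ℕ) (hn : 2 ≤ n) : Iab n (N+k) ≤ Iab n N := by
  induction k with
  | zero => exact le_rfl
  | succ k ih => exact (Iab_anti n (N+k) hn).trans ih

lemma Iab_ratio (n k : ℕ) (hn : 2 ≤ n) :
    Filter.Tendsto (fun N => Iab n (N+k) / Iab n N) Filter.atTop (𝓝 1) := by
  induction k with
  | zero => 
    have : (fun N => Iab n (N+0) / Iab n N) = fun _ => 1 := by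
      ext N; simp [(Iab_pos n N).ne']
    rw [this]; exact tendsto_const_nhds
  | succ k ih =>
    have h1 : Filter.Tendsto (fun N : ℕ => 1 - ((n:ℝ)-1) / (((N:ℝ)+(k+n)))) Filter.atTop (𝓝 (1 - 0)) := by
      refine tendsto_const_nhds.sub (tendsto_const_nhds.div_atTop ?_)
      exact Filter.tendsto_atTop_add_const_right _ _ tendsto_natCast_atTop_atTop
    have h2 := ih.mul h1
    simp only [sub_zero, mul_one] at h2
    refine h2.congr fun N => ?_
    have h := Iab_rec n (N+k) hn
    have h5 : (2:ℝ) ≤ n := by exact_mod_cast hn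
    have h6 : (0:ℝ) < N + (k+n) := by positivity
    have h7 := Iab_pos n N
    rw [show N + (k+1) = N+k+1 from rfl]
    push_cast at h
    rw [div_mul_eq_mul_div]
    congr 1
    have e : 1 - ((n:ℝ)-1) / ((N:ℝ)+(k+n)) = (N+k+1)/((N:ℝ)+k+n) := by
      field_simp; ring
    rw [e, mul_div_assoc', ← h, mul_div_assoc, div_self (by linarith), mul_one]

lemma re_kernel {w : ℂ} (hw : ‖w‖ < 1) : ((1+w)/(1-w)).re = (1 - ‖w‖^2) / ‖1-w‖^2 := by
  have hne : 1 - w ≠ 0 := by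
    rw [sub_ne_zero]; rintro rfl; simp at hw
  rw [Complex.div_re, ← Complex.normSq_eq_norm_sq, ← Complex.normSq_eq_norm_sq, ← add_div]
  congr 1
  simp [Complex.normSq_apply]; ring

section
variable {n : ℕ} (hn : 2 ≤ n) (μ : Measure (EuclideanSpace ℂ (Fin n))) [IsFiniteMeasure μ]
  (hsupp : μ (unitSphere n)ᶜ = 0) (hpl : Pluri μ)
include hsupp hn 

lemma hasSum_int (ζ : EuclideanSpace ℂ (Fin n)) (hζ : ‖ζ‖ = 1) {r : ℝ} (h0 : 0 ≤ r) (h1 : r < 1) (N : ℕ) :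
    HasSum (fun k => bk μ ζ k * (r:ℂ) ^ k * (Iab n (N+k) : ℂ))
      (∫ x in (0:ℝ)..1, (wgt n N x : ℂ) * fF μ (((r * x : ℝ):ℂ) • ζ)) := by
  have := intervalIntegral.hasSum_integral_of_dominated_convergence (μ := volume) (a := 0) (b := 1)
    (F := fun (k:ℕ) (x:ℝ) => (bk μ ζ k * (r:ℂ) ^ k) * (wgt n (N+k) x : ℂ))
    (f := fun x => (wgt n N x : ℂ) * fF μ (((r * x : ℝ):ℂ) • ζ))
    (fun k _ => ‖bk μ ζ k‖ * r ^ k * (n-1)) ?_ ?_ ?_ ?_ ?_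
  · refine hasSum_cg this ?_ rfl
    intro k
    rw [intervalIntegral.integral_const_mul, intervalIntegral.integral_ofReal, wgt_int n _ hn]
  · intro k
    refine Continuous.aestronglyMeasurable ?_
    unfold wgt; fun_prop
  · intro k
    refine Filter.Eventually.of_forall fun x hx => ?_
    rw [uIoc_of_le zero_le_one] at hx
    have h5 : (2:ℝ) ≤ n := by exact_mod_cast hn
    rw [norm_mul, norm_mul, norm_pow, Complex.norm_real, Complex.norm_real, Real.norm_of_nonneg h0]
    have h6 : 0 ≤ 1 - x := by linarith [hx.2]
    have h7 : 0 ≤ x := hx.1.le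
    have : x ^ (N+k) * (1-x)^(n-2) ≤ 1 := mul_le_one₀ (pow_le_one₀ h7 hx.2) (by positivity) (pow_le_one₀ h6 (by linarith))
    have h8 : 0 ≤ (n:ℝ) - 1 := by linarith
    rw [Real.norm_of_nonneg (by unfold wgt; positivity)]
    gcongr
    unfold wgt
    nlinarith
  · exact Filter.Eventually.of_forall fun x _ => (summable_bk μ hsupp ζ hζ h0 h1).mul_right _
  · simp
  · refine Filter.Eventually.of_forall fun x hx => ?_
    rw [uIoc_of_le zero_le_one] at hx
    have := (hasSum_fF hn μ hsupp ζ hζ (r := r * x) (mul_nonneg h0 hx.1.le) (by nlinarith [hx.1, hx.2])).mul_left (wgt n N x : ℂ)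
    refine hasSum_cg this ?_ rfl
    intro k
    simp only [wgt]
    push_cast
    ring

lemma re_G_eq (ζ : EuclideanSpace ℂ (Fin n)) (hζ : ‖ζ‖ = 1) {r : ℝ} (h0 : 0 ≤ r) (h1 : r < 1) (N : ℕ) :
    ∫ ξ, (‖(inner ℂ ξ ζ : ℂ)‖ ^ 2) ^ N * ((1 - ‖r * (inner ℂ ξ ζ : ℂ)‖^2) / ‖1 - r * (inner ℂ ξ ζ : ℂ)‖^2) ∂μ
     = (∫ ξ, ((‖(inner ℂ ξ ζ : ℂ)‖ ^ 2 : ℝ) : ℂ) ^ N * ((1 + r * inner ℂ ξ ζ) / (1 - r * inner ℂ ξ ζ)) ∂μ).re := by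
  have hi : Integrable (fun ξ => ((‖(inner ℂ ξ ζ : ℂ)‖ ^ 2 : ℝ) : ℂ) ^ N * ((1 + r * inner ℂ ξ ζ) / (1 - r * inner ℂ ξ ζ))) μ := by
    refine integrable_cont μ hsupp ?_ (2 / (1 - r)) ?_
    · have := meas_inner ζ
      exact Measurable.aestronglyMeasurable (by fun_prop)
    · intro ξ hξ
      have h := norm_inner_le_one hξ hζ
      have hw : ‖(r:ℂ) * inner ℂ ξ ζ‖ ≤ r := by
        rw [norm_mul, Complex.norm_real, Real.norm_of_nonneg h0]
        exact mul_le_of_le_one_right h0 h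
      rw [norm_mul, norm_pow, Complex.norm_real (‖_‖^2), norm_pow, norm_norm, norm_div]
      have h2 := norm_sub_norm_le (1:ℂ) (r * inner ℂ ξ ζ)
      have h3 := norm_add_le (1:ℂ) (r * inner ℂ ξ ζ)
      rw [norm_one] at h2 h3
      have h4 : 0 < 1 - r := by linarith
      calc _ ≤ 1 * (2 / (1-r)) := by
            gcongr
            · exact pow_le_one₀ (by positivity) (pow_le_one₀ (norm_nonneg _) h)
            · linarith
            · linarith
        _ = _ := one_mul _
  have := integral_re hi
  simp only [RCLike.re_to_complex] at this
  rw [← this]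
  refine integral_congr_ae ?_
  filter_upwards [ae_sphere hsupp] with ξ hξ
  have hw : ‖(r:ℂ) * inner ℂ ξ ζ‖ < 1 := by
    rw [norm_mul, Complex.norm_real, Real.norm_of_nonneg h0]
    exact (mul_le_of_le_one_right h0 (norm_inner_le_one hξ hζ)).trans_lt h1
  rw [← Complex.ofReal_pow, Complex.re_ofReal_mul, re_kernel hw]

include hpl in
lemma u_nonneg_aux (ζ : EuclideanSpace ℂ (Fin n)) (hζ : ‖ζ‖ = 1) {r : ℝ} (h0 : 0 ≤ r) (h1 : r < 1) :
    0 ≤ (fF μ ((r:ℂ) • ζ)).re := by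
  have hT : Filter.Tendsto (fun N : ℕ => ∑' k, bk μ ζ k * (r:ℂ) ^ k * ((Iab n (N+k) / Iab n N : ℝ) : ℂ)) Filter.atTop (𝓝 (∑' k, bk μ ζ k * (r:ℂ)^k * 1)) := by
    refine tendsto_tsum_of_dominated_convergence (summable_bk μ hsupp ζ hζ h0 h1) ?_ ?_
    · intro k
      refine tendsto_const_nhds.mul ?_
      have := (Complex.continuous_ofReal.tendsto 1).comp (Iab_ratio n k hn)
      simpa [Function.comp_def] using this
    · refine Filter.Eventually.of_forall fun N k => ?_
      rw [norm_mul, norm_mul, norm_pow, Complex.norm_real, Complex.norm_real, Real.norm_of_nonneg h0,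
        Real.norm_of_nonneg (div_nonneg (Iab_pos _ _).le (Iab_pos _ _).le)]
      exact mul_le_of_le_one_right (by positivity) ((div_le_one (Iab_pos _ _)).2 (Iab_anti' n N k hn))
  simp only [mul_one] at hT
  rw [(hasSum_fF hn μ hsupp ζ hζ h0 h1).tsum_eq] at hT
  have hT2 := (Complex.continuous_re.tendsto _).comp hT
  refine ge_of_tendsto' hT2 fun N => ?_
  have h := (hasSum_G hn μ hsupp ζ hζ hpl h0 h1 N).div_const (Iab n N : ℂ)
  have h' := hasSum_cg (g := fun k => bk μ ζ k * (r:ℂ) ^ k * ((Iab n (N+k) / Iab n N : ℝ) : ℂ)) h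
    (fun k => by push_cast; ring) rfl
  simp only [Function.comp]
  rw [h'.tsum_eq, Complex.div_ofReal_re, ← re_G_eq hn μ hsupp ζ hζ h0 h1]
  refine div_nonneg (integral_nonneg_of_ae ?_) (Iab_pos _ _).le
  filter_upwards [ae_sphere hsupp] with ξ hξ
  have hw : ‖(r:ℂ) * inner ℂ ξ ζ‖ < 1 := by
    rw [norm_mul, Complex.norm_real, Real.norm_of_nonneg h0]
    exact (mul_le_of_le_one_right h0 (norm_inner_le_one hξ hζ)).trans_lt h1
  have : 0 ≤ 1 - ‖(r:ℂ) * inner ℂ ξ ζ‖^2 := by nlinarith [norm_nonneg ((r:ℂ) * inner ℂ ξ ζ)]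
  simp only [Pi.zero_apply]
  positivity

include hpl in
lemma u_nonneg {z : EuclideanSpace ℂ (Fin n)} (hz : ‖z‖ < 1) : 0 ≤ (fF μ z).re := by
  rcases eq_or_ne z 0 with rfl | hne
  · have := u_nonneg_aux hn μ hsupp hpl (EuclideanSpace.single (⟨0, by omega⟩ : Fin n) 1) (by simp) le_rfl zero_lt_one
    simpa using this
  · have := u_nonneg_aux hn μ hsupp hpl ((‖z‖⁻¹ : ℂ) • z) (by rw [norm_smul]; simp [hne]) (norm_nonneg z) hz
    rw [smul_smul, mul_inv_cancel₀ (by simpa using hne), one_smul] at this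
    exact this

lemma slice_diff (ζ : EuclideanSpace ℂ (Fin n)) (hζ : ‖ζ‖ = 1) :
    DifferentiableOn ℂ (fun l : ℂ => fF μ (l • ζ)) (ball 0 1) := by
  intro l hl
  have h : ‖l • ζ‖ < 1 := by rw [norm_smul, hζ, mul_one]; simpa using hl
  have h1 := fF_differentiableAt μ hsupp h
  exact (DifferentiableAt.comp (g := fF μ) (f := fun l : ℂ => l • ζ) l h1 (by fun_prop)).differentiableWithinAt

include hpl in
lemma slice_nonneg (ζ : EuclideanSpace ℂ (Fin n)) (hζ : ‖ζ‖ = 1) :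
    ∀ l ∈ ball (0:ℂ) 1, 0 ≤ (fF μ (l • ζ)).re := by
  intro l hl
  exact u_nonneg hn μ hsupp hpl (by rw [norm_smul, hζ, mul_one]; simpa using hl)

include hpl in
/-- Harnack along a radius. -/
lemma radial_harnack (ζ : EuclideanSpace ℂ (Fin n)) (hζ : ‖ζ‖ = 1) {s r : ℝ} (h0 : 0 ≤ s) (hsr : s ≤ r) (h1 : r < 1) :
    (fF μ ((s:ℂ) • ζ)).re * ((1-r)*(1+s)) ≤ (fF μ ((r:ℂ) • ζ)).re * ((1+r)*(1-s)) ∧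
    (fF μ ((r:ℂ) • ζ)).re * ((1-r)*(1+s)) ≤ (fF μ ((s:ℂ) • ζ)).re * ((1+r)*(1-s)) := by
  have hr : ‖(r:ℂ)‖ < 1 := by rw [Complex.norm_real, Real.norm_of_nonneg (h0.trans hsr)]; exact h1
  have hs : ‖(s:ℂ)‖ < 1 := by rw [Complex.norm_real, Real.norm_of_nonneg h0]; linarith
  have a1 := harnack2 (slice_diff hn μ hsupp ζ hζ) (slice_nonneg hn μ hsupp hpl ζ hζ) hs hr
  have a2 := harnack2 (slice_diff hn μ hsupp ζ hζ) (slice_nonneg hn μ hsupp hpl ζ hζ) hr hs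
  rw [Complex.conj_ofReal, ← Complex.ofReal_one, ← Complex.ofReal_mul, ← Complex.ofReal_sub, ← Complex.ofReal_sub, Complex.norm_real, Complex.norm_real,
    Real.norm_of_nonneg (by nlinarith)] at a1 a2
  rw [Real.norm_of_nonpos (by linarith)] at a1
  rw [Real.norm_of_nonneg (by linarith)] at a2
  constructor
  · convert a1 using 2 <;> ring
  · convert a2 using 2 <;> ring
end

end C2part

noncomputable section C3part
lemma Iab_upper (n N : ℕ) : Iab n N ≤ (n-1).factorial / ((N:ℝ)+1)^(n-1) := by
  have h := Nat.pow_le_choose (α := ℝ) (n-1) (N+(n-1))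
  rw [show N + (n-1) + 1 - (n-1) = N + 1 by omega] at h
  unfold Iab binC
  have h2 : (0:ℝ) < (((N+1:ℕ):ℝ) ^ (n-1)) / ((n-1).factorial : ℝ) := by positivity
  calc _ ≤ ((((N+1:ℕ):ℝ) ^ (n-1)) / ((n-1).factorial : ℝ))⁻¹ := inv_anti₀ h2 h
    _ = _ := by rw [inv_div]; push_cast; rfl

def Kn (n : ℕ) : ℝ := (n-1).factorial * 2 ^ (n-1)
lemma Kn_pos (n : ℕ) : 0 < Kn n := by unfold Kn; positivity

/-- choice of exponent -/
lemma exists_N (n : ℕ) {ρ : ℝ} (hρ : 0 < ρ) :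
    ∃ N : ℕ, (∀ t : ℝ, 0 ≤ t → 1 - ρ^2 ≤ t → 1/2 ≤ t ^ N) ∧ Iab n N ≤ Kn n * ρ ^ (2*(n-1)) ∧ 1/(2*ρ^2) ≤ N + 1 := by
  refine ⟨⌊1/(2*ρ^2)⌋₊, ?_, ?_, ?_⟩
  · intro t ht0 ht
    set N := ⌊1/(2*ρ^2)⌋₊ with hN
    rcases Nat.eq_zero_or_pos N with h | h
    · rw [h]; norm_num
    have h1 : (N:ℝ) ≤ 1/(2*ρ^2) := Nat.floor_le (by positivity)
    have h2 : (1:ℝ) ≤ N := by exact_mod_cast h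
    have h3 : (N:ℝ) * (2*ρ^2) ≤ 1 := by rwa [le_div_iff₀ (by positivity)] at h1
    have h4 : ρ^2 ≤ 1/2 := by nlinarith [sq_nonneg ρ]
    have h5 := one_add_mul_le_pow (a := -ρ^2) (by linarith) N
    calc (1/2:ℝ) ≤ 1 + N * (-ρ^2) := by nlinarith
      _ ≤ _ := h5
      _ ≤ _ := by apply pow_le_pow_left₀ <;> linarith
  · refine (Iab_upper n _).trans ?_
    have h1 := (Nat.lt_floor_add_one (1/(2*ρ^2))).le
    have h2 : (0:ℝ) < (1/(2*ρ^2))^(n-1) := by positivity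
    calc _ ≤ ((n-1).factorial:ℝ) / (1/(2*ρ^2))^(n-1) := by gcongr
      _ = _ := by
        unfold Kn
        rw [div_pow, one_pow, div_div_eq_mul_div, div_one, mul_pow, ← pow_mul]; ring
  · exact (Nat.lt_floor_add_one (1/(2*ρ^2))).le

def kern {n : ℕ} (ζ : EuclideanSpace ℂ (Fin n)) (r : ℝ) (N : ℕ) (ξ : EuclideanSpace ℂ (Fin n)) : ℝ :=
  (‖(inner ℂ ξ ζ : ℂ)‖ ^ 2) ^ N * ((1 - ‖r * (inner ℂ ξ ζ : ℂ)‖^2) / ‖1 - r * (inner ℂ ξ ζ : ℂ)‖^2)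

lemma nrw {n : ℕ} {ξ ζ : EuclideanSpace ℂ (Fin n)} (hξ : ‖ξ‖ = 1) (hζ : ‖ζ‖ = 1) {r : ℝ} (h0 : 0 ≤ r) :
    ‖(r:ℂ) * inner ℂ ξ ζ‖ ≤ r := by
  rw [norm_mul, Complex.norm_real, Real.norm_of_nonneg h0]
  exact (mul_le_of_le_one_right h0 (norm_inner_le_one hξ hζ))

lemma kern_nonneg {n : ℕ} {ξ ζ : EuclideanSpace ℂ (Fin n)} (hξ : ‖ξ‖ = 1) (hζ : ‖ζ‖ = 1) {r : ℝ} (h0 : 0 ≤ r) (h1 : r < 1) (N : ℕ) :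
    0 ≤ kern ζ r N ξ := by
  have := nrw hξ hζ h0
  have : 0 ≤ 1 - ‖(r:ℂ) * inner ℂ ξ ζ‖^2 := by nlinarith [norm_nonneg ((r:ℂ) * inner ℂ ξ ζ)]
  unfold kern
  positivity

section
variable {n : ℕ} (hn : 2 ≤ n) (μ : Measure (EuclideanSpace ℂ (Fin n))) [IsFiniteMeasure μ]
  (hsupp : μ (unitSphere n)ᶜ = 0) (hpl : Pluri μ)
include hsupp  

lemma kern_integrable (ζ : EuclideanSpace ℂ (Fin n)) (hζ : ‖ζ‖ = 1) {r : ℝ} (h0 : 0 ≤ r) (h1 : r < 1) (N : ℕ) :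
    Integrable (kern ζ r N) μ := by
  refine Integrable.of_bound ?_ (1 / (1-r)^2) ?_
  · have := meas_inner ζ
    unfold kern
    exact Measurable.aestronglyMeasurable (by fun_prop)
  · filter_upwards [ae_sphere hsupp] with ξ hξ
    rw [Real.norm_of_nonneg (kern_nonneg hξ hζ h0 h1 N)]
    have h := norm_inner_le_one hξ hζ
    have h2 := nrw hξ hζ h0
    have h3 := norm_sub_norm_le (1:ℂ) (r * inner ℂ ξ ζ)
    rw [norm_one] at h3
    have h4 : 0 < 1 - r := by linarith
    have h5 : 0 ≤ 1 - ‖(r:ℂ) * inner ℂ ξ ζ‖^2 := by nlinarith [norm_nonneg ((r:ℂ) * inner ℂ ξ ζ)]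
    unfold kern
    calc _ ≤ 1 * (1 / (1-r)^2) := by
          gcongr
          · exact pow_le_one₀ (by positivity) (pow_le_one₀ (norm_nonneg _) h)
          · nlinarith [norm_nonneg ((r:ℂ) * inner ℂ ξ ζ)]
          · linarith
      _ = _ := one_mul _

include hn hpl

lemma kern_upper (ζ : EuclideanSpace ℂ (Fin n)) (hζ : ‖ζ‖ = 1) {r : ℝ} (h0 : 0 ≤ r) (h1 : r < 1) (N : ℕ)
    (hN : (n:ℝ) ≤ (N + 1) * (1-r)) :
    ∫ ξ, kern ζ r N ξ ∂μ ≤ 4 * Iab n N * (fF μ ((r:ℂ) • ζ)).re := by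
  have e1 : ∫ ξ, kern ζ r N ξ ∂μ = (∫ x in (0:ℝ)..1, (wgt n N x : ℂ) * fF μ (((r * x : ℝ):ℂ) • ζ)).re := by
    unfold kern
    rw [re_G_eq hn μ hsupp ζ hζ h0 h1 N, (hasSum_G hn μ hsupp ζ hζ hpl h0 h1 N).unique (hasSum_int hn μ hsupp ζ hζ h0 h1 N)]
  have hwc : ∀ N, Continuous (wgt n N) := by intro N; unfold wgt; fun_prop
  have hc : ContinuousOn (fun x : ℝ => fF μ (((r * x : ℝ):ℂ) • ζ)) (Icc 0 1) := by
    have h := (slice_diff hn μ hsupp ζ hζ).continuousOn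
    refine h.comp (f := fun x : ℝ => ((r * x : ℝ):ℂ)) (by fun_prop) ?_
    intro x hx
    simp only [mem_ball, dist_zero_right, Complex.norm_real]
    rw [Real.norm_of_nonneg (mul_nonneg h0 hx.1)]
    nlinarith [hx.1, hx.2]
  have hc2 : ContinuousOn (fun x : ℝ => (wgt n N x : ℂ) * fF μ (((r * x : ℝ):ℂ) • ζ)) (Icc 0 1) :=
    ContinuousOn.mul (by have := hwc N; fun_prop) hc
  have hii : IntervalIntegrable (fun x : ℝ => (wgt n N x : ℂ) * fF μ (((r * x : ℝ):ℂ) • ζ)) volume 0 1 :=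
    ContinuousOn.intervalIntegrable (by rwa [uIcc_of_le zero_le_one])
  rw [e1]
  have e2 : (∫ x in (0:ℝ)..1, (wgt n N x : ℂ) * fF μ (((r * x : ℝ):ℂ) • ζ)).re = 
      ∫ x in (0:ℝ)..1, wgt n N x * (fF μ (((r * x : ℝ):ℂ) • ζ)).re := by
    have := Complex.reCLM.intervalIntegral_comp_comm hii
    simp only [Complex.reCLM_apply, Complex.re_ofReal_mul] at this
    exact this.symm
  rw [e2]
  set U := (fF μ ((r:ℂ) • ζ)).re with hU
  have hU0 : 0 ≤ U := u_nonneg_aux hn μ hsupp hpl ζ hζ h0 h1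
  have h4 : 0 < 1 - r := by linarith
  have h5 : (2:ℝ) ≤ n := by exact_mod_cast hn
  have hw1 : ∀ x, wgt n (N+1) x = wgt n N x * x := by intro x; unfold wgt; ring
  have step : ∫ x in (0:ℝ)..1, wgt n N x * (fF μ (((r * x : ℝ):ℂ) • ζ)).re ≤
      ∫ x in (0:ℝ)..1, ((2 * U / (1-r)) * ((2 - r) * wgt n N x - wgt n (N+1) x)) := by
    refine intervalIntegral.integral_mono_on zero_le_one ?_ ?_ ?_
    · refine ContinuousOn.intervalIntegrable ?_
      rw [uIcc_of_le zero_le_one]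
      exact (hwc N).continuousOn.mul (Complex.continuous_re.comp_continuousOn hc)
    · have h1 := hwc N; have h2 := hwc (N+1)
      exact Continuous.intervalIntegrable (by fun_prop) _ _
    · intro x hx
      have hrx : r * x ≤ r := mul_le_of_le_one_right h0 hx.2
      have hrx0 : 0 ≤ r * x := mul_nonneg h0 hx.1
      have h := (radial_harnack hn μ hsupp hpl ζ hζ hrx0 hrx h1).1
      have hux := u_nonneg_aux hn μ hsupp hpl ζ hζ hrx0 (hrx.trans_lt h1)
      set V := (fF μ (((r * x : ℝ):ℂ) • ζ)).re
      have hw0 : 0 ≤ wgt n N x := by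
        have h6 : 0 ≤ 1 - x := by linarith [hx.2]
        have h8 : 0 ≤ (n:ℝ) - 1 := by linarith
        have := hx.1
        unfold wgt; positivity
      rw [hw1, show (2 * U / (1-r)) * ((2 - r) * wgt n N x - wgt n N x * x) = wgt n N x * ((2 * U / (1-r)) * (2 - r - x)) by ring]
      refine mul_le_mul_of_nonneg_left ?_ hw0
      rw [div_mul_eq_mul_div, le_div_iff₀ h4]
      have a1 : V * (1-r) ≤ V * ((1-r)*(1+r*x)) := by
        apply mul_le_mul_of_nonneg_left _ hux; nlinarith
      have a2 : U * ((1+r)*(1-r*x)) ≤ 2 * U * (2 - r - x) := by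
        have : (1+r)*(1-r*x) ≤ 2 * (2-r-x) := by
          have b1 : 1 - r*x ≤ 2 - r - x := by nlinarith [hx.1, hx.2]
          have b2 : 0 ≤ 1 - r * x := by linarith
          nlinarith
        nlinarith
      linarith
  refine step.trans ?_
  rw [intervalIntegral.integral_const_mul, intervalIntegral.integral_sub, intervalIntegral.integral_const_mul, wgt_int n N hn, wgt_int n _ hn]
  rotate_left
  · exact ((hwc N).const_mul _).intervalIntegrable _ _
  · exact (hwc _).intervalIntegrable _ _
  have hr := Iab_rec n N hn
  have hp := Iab_pos n N
  have hNn : (0:ℝ) < N + n := by positivity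
  have key : (2-r) * Iab n N - Iab n (N+1) ≤ 2 * (1-r) * Iab n N := by
    have : Iab n (N+1) * (N+n) ≥ r * Iab n N * (N+n) := by
      rw [hr, ge_iff_le, mul_comm r, mul_assoc]
      refine mul_le_mul_of_nonneg_left ?_ hp.le
      nlinarith
    have := le_of_mul_le_mul_right this hNn
    linarith
  calc 2 * U / (1-r) * ((2-r) * Iab n N - Iab n (N+1)) ≤ 2 * U / (1-r) * (2 * (1-r) * Iab n N) := by gcongr
    _ = _ := by field_simp; ring

lemma cap_bound (ζ : EuclideanSpace ℂ (Fin n)) (hζ : ‖ζ‖ = 1) {ρ : ℝ} (hρ : 0 < ρ) :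
    μ.real {ξ | 1 - ρ^2 ≤ ‖(inner ℂ ξ ζ : ℂ)‖ ^ 2} ≤ 2 * μ.real univ * Kn n * ρ ^ (2*(n-1)) := by
  obtain ⟨N, hN1, hN2, -⟩ := exists_N n hρ
  have h := moments μ hn hsupp hpl ζ hζ 0 N
  simp only [pow_zero, mul_one, integral_const, add_zero] at h
  have h2 : ∫ ξ, (‖(inner ℂ ξ ζ : ℂ)‖ ^ 2) ^ N ∂μ = Iab n N * μ.real univ := by
    have e : ∀ ξ : EuclideanSpace ℂ (Fin n), ((‖(inner ℂ ξ ζ : ℂ)‖ ^ 2 : ℝ) : ℂ) ^ N = (((‖(inner ℂ ξ ζ : ℂ)‖ ^ 2) ^ N : ℝ) : ℂ) := by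
      intro ξ; push_cast; rfl
    simp only [e, integral_complex_ofReal] at h
    have hb : binC n 0 = 1 := by simp [binC]
    rw [hb] at h
    simp at h
    exact_mod_cast h
  have hint : Integrable (fun ξ => (‖(inner ℂ ξ ζ : ℂ)‖ ^ 2) ^ N) μ := by
    refine Integrable.of_bound (Continuous.aestronglyMeasurable (by fun_prop)) 1 ?_
    filter_upwards [ae_sphere hsupp] with ξ hξ
    rw [Real.norm_of_nonneg (by positivity)]
    exact pow_le_one₀ (by positivity) (pow_le_one₀ (norm_nonneg _) (norm_inner_le_one hξ hζ))
  have hM := mul_meas_ge_le_integral_of_nonneg (μ := μ) (f := fun ξ => (‖(inner ℂ ξ ζ : ℂ)‖ ^ 2) ^ N)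
    (Filter.Eventually.of_forall fun ξ => by positivity) hint (1/2)
  rw [h2] at hM
  have hsub : μ.real {ξ | 1 - ρ^2 ≤ ‖(inner ℂ ξ ζ : ℂ)‖ ^ 2} ≤ μ.real {ξ | 1/2 ≤ (‖(inner ℂ ξ ζ : ℂ)‖ ^ 2) ^ N} := by
    apply measureReal_mono _ (measure_ne_top _ _)
    intro ξ hξ
    exact hN1 _ (by positivity) hξ
  have : Iab n N * μ.real univ ≤ Kn n * ρ ^ (2*(n-1)) * μ.real univ := by gcongr
  linarith

lemma ball_bound (ζ : EuclideanSpace ℂ (Fin n)) (hζ : ‖ζ‖ = 1) {τ ρ : ℝ} (hτ : 0 < τ) (hτ1 : τ ≤ 1) (hρ : 0 < ρ)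
    (hρτ : ρ ≤ τ) (hρ2 : 2 * n * ρ^2 ≤ τ) :
    μ.real (closedBall ζ ρ) ≤ 32 * Kn n * ρ ^ (2*(n-1)) * (τ * (fF μ (((1-τ : ℝ):ℂ) • ζ)).re) := by
  obtain ⟨N, hN1, hN2, hN3⟩ := exists_N n hρ
  have h0 : 0 ≤ 1 - τ := by linarith
  have h1 : 1 - τ < 1 := by linarith
  have hNn : (n:ℝ) ≤ (N+1) * (1 - (1-τ)) := by
    rw [div_le_iff₀ (by positivity)] at hN3
    have h5 : (2:ℝ) ≤ n := by exact_mod_cast hn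
    rw [sub_sub_cancel]
    have : (0:ℝ) < N + 1 := by positivity
    nlinarith
  have hup := kern_upper hn μ hsupp hpl ζ hζ h0 h1 N hNn
  have hM := mul_meas_ge_le_integral_of_nonneg (μ := μ) (f := kern ζ (1-τ) N)
    (by filter_upwards [ae_sphere hsupp] with ξ hξ using kern_nonneg hξ hζ h0 h1 N) (kern_integrable μ hsupp ζ hζ h0 h1 N) (1/(8*τ))
  have hsub : μ.real (closedBall ζ ρ) ≤ μ.real {ξ | 1/(8*τ) ≤ kern ζ (1-τ) N ξ} := by
    refine ENNReal.toReal_mono (measure_ne_top _ _) (measure_mono_ae ?_)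
    filter_upwards [ae_sphere hsupp] with ξ hξ hmem
    have hd : ‖ξ - ζ‖ ≤ ρ := by
      have : ξ ∈ closedBall ζ ρ := hmem
      rwa [mem_closedBall, dist_eq_norm] at this
    show 1/(8*τ) ≤ kern ζ (1-τ) N ξ
    have hw := norm_inner_le_one hξ hζ
    set w : ℂ := inner ℂ ξ ζ with hwdef
    have e1 : ‖1 - w‖ ≤ ρ := by
      have : 1 - w = inner ℂ ξ (ξ - ζ) := by
        rw [inner_sub_right, inner_self_eq_norm_sq_to_K, hξ]; simp [hwdef]
      rw [this]
      refine (norm_inner_le_norm _ _).trans ?_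
      rw [hξ, one_mul]; exact hd
    have e2 : 1 - ρ^2 ≤ ‖w‖^2 := by
      have h := @norm_sub_sq ℂ _ _ _ _ ξ ζ
      rw [hξ, hζ] at h
      have h' : ‖ξ - ζ‖^2 ≤ ρ^2 := by gcongr
      simp only [RCLike.re_to_complex] at h
      rw [h] at h'
      have hre : w.re ≤ ‖w‖ := Complex.re_le_norm w
      nlinarith [sq_nonneg (1 - ‖w‖)]
    have e3 : ‖1 - ((1-τ:ℝ):ℂ) * w‖ ≤ 2 * τ := by
      have : 1 - ((1-τ:ℝ):ℂ) * w = (τ:ℂ) + ((1-τ:ℝ):ℂ) * (1-w) := by push_cast; ring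
      rw [this]
      refine (norm_add_le _ _).trans ?_
      rw [norm_mul, Complex.norm_real, Complex.norm_real, Real.norm_of_nonneg hτ.le, Real.norm_of_nonneg h0]
      nlinarith [norm_nonneg (1-w)]
    have e4 : τ ≤ 1 - ‖((1-τ:ℝ):ℂ) * w‖^2 := by
      have := nrw hξ hζ h0
      nlinarith [norm_nonneg (((1-τ:ℝ):ℂ) * w)]
    have e5 : 0 < ‖1 - ((1-τ:ℝ):ℂ) * w‖ := by
      have := nrw hξ hζ h0
      have h3 := norm_sub_norm_le (1:ℂ) (((1-τ:ℝ):ℂ) * w)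
      rw [norm_one] at h3
      linarith
    have := hN1 (‖w‖^2) (by positivity) e2
    unfold kern
    calc 1/(8*τ) = 1/2 * (τ / (2*τ)^2) := by field_simp; norm_num
      _ ≤ _ := by gcongr; linarith
  have hU0 : 0 ≤ (fF μ (((1-τ:ℝ):ℂ) • ζ)).re := u_nonneg_aux hn μ hsupp hpl ζ hζ h0 h1
  set U := (fF μ (((1-τ:ℝ):ℂ) • ζ)).re
  have h6 : 1/(8*τ) * μ.real (closedBall ζ ρ) ≤ 4 * (Kn n * ρ ^ (2*(n-1))) * U := by
    calc _ ≤ 1/(8*τ) * μ.real {ξ | 1/(8*τ) ≤ kern ζ (1-τ) N ξ} := by gcongr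
      _ ≤ _ := hM.trans hup
      _ ≤ _ := by gcongr
  rw [div_mul_eq_mul_div, one_mul, div_le_iff₀ (by positivity)] at h6
  linarith
end

end C3part

noncomputable section Dpart
lemma lemL {X : Type*} [MetricSpace X] [MeasurableSpace X] [BorelSpace X] (m : Measure X)
    {A : Set X} (hA : MeasurableSet A) {K d ρ0 : ℝ} (hK : 0 < K) (hd : 0 < d) (hρ0 : 0 < ρ0)
    (h : ∀ z ∈ A, ∀ ρ, 0 < ρ → ρ ≤ ρ0 → m (closedBall z ρ) ≤ ENNReal.ofReal (K * ρ ^ d)) :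
    m A ≤ ENNReal.ofReal K * μH[d] A := by
  have hK0 : ENNReal.ofReal K ≠ 0 := by simpa using hK
  have key : (ENNReal.ofReal K)⁻¹ • m.restrict A ≤ μH[d] := by
    refine Measure.le_hausdorffMeasure d _ (ENNReal.ofReal (ρ0/2)) (by simpa using hρ0) ?_
    intro s hs
    rw [Measure.smul_apply, smul_eq_mul, ENNReal.inv_mul_le_iff hK0 ENNReal.ofReal_ne_top,
      Measure.restrict_apply' hA]
    rcases (s ∩ A).eq_empty_or_nonempty with he | ⟨z, hzs, hzA⟩
    · rw [he]; simp
    have hfin : ediam s ≠ ⊤ := ne_top_of_le_ne_top ENNReal.ofReal_ne_top hs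
    set D := (ediam s).toReal with hD
    have hD0 : 0 ≤ D := ENNReal.toReal_nonneg
    have hD1 : D ≤ ρ0/2 := ENNReal.toReal_le_of_le_ofReal (by positivity) hs
    have e1 : ediam s = ENNReal.ofReal D := (ENNReal.ofReal_toReal hfin).symm
    rw [e1, ENNReal.ofReal_rpow_of_nonneg hD0 hd.le, ← ENNReal.ofReal_mul hK.le]
    have ht : Filter.Tendsto (fun ρ : ℝ => ENNReal.ofReal (K * ρ ^ d)) (𝓝[>] D)
        (𝓝 (ENNReal.ofReal (K * D ^ d))) := by
      apply Filter.Tendsto.mono_left _ nhdsWithin_le_nhds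
      apply Continuous.tendsto
      exact ENNReal.continuous_ofReal.comp (continuous_const.mul (Real.continuous_rpow_const hd.le))
    refine ge_of_tendsto ht ?_
    filter_upwards [Ioc_mem_nhdsGT (show D < ρ0 by linarith)] with ρ hρ
    refine le_trans (measure_mono ?_) (h z hzA ρ (by linarith [hρ.1]) hρ.2)
    rintro x ⟨hx, _⟩
    rw [mem_closedBall, dist_edist]
    refine le_trans (ENNReal.toReal_mono hfin (edist_le_ediam_of_mem hx hzs)) hρ.1.le
  have := key A
  rwa [Measure.smul_apply, smul_eq_mul, ENNReal.inv_mul_le_iff hK0 ENNReal.ofReal_ne_top,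
    Measure.restrict_apply_self] at this

lemma finrank_V (n : ℕ) : Module.finrank ℝ (EuclideanSpace ℂ (Fin n)) = 2 * n := by
  rw [finrank_real_of_complex]; simp

lemma lemD3 {n : ℕ} (hn : 2 ≤ n) {T : Set (EuclideanSpace ℂ (Fin n))} (hT : MeasurableSet T)
    (e : EuclideanSpace ℂ (Fin n))
    (h : ∀ y : EuclideanSpace ℂ (Fin n), y ∉ Submodule.span ℂ {e} →
      volume {x : ℂ | y + x • e ∈ T} = 0) :
    (μH[2 * (n:ℝ)] : Measure (EuclideanSpace ℂ (Fin n))) T = 0 := by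
  set ν : Measure (EuclideanSpace ℂ (Fin n)) := μH[2 * (n:ℝ)] with hν
  haveI : ν.IsAddHaarMeasure := by
    have : (2 * (n:ℝ)) = (Module.finrank ℝ (EuclideanSpace ℂ (Fin n)) : ℕ) := by
      rw [finrank_V]; push_cast; rfl
    rw [hν, this]; infer_instance
  let W : Submodule ℂ (EuclideanSpace ℂ (Fin n)) := Submodule.span ℂ {e}
  have hWtop : W.restrictScalars ℝ ≠ ⊤ := by
    intro h1
    have h2 : W = ⊤ := by
      rw [eq_top_iff]; intro x _
      have : x ∈ W.restrictScalars ℝ := by rw [h1]; trivial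
      exact this
    have h3 : Module.finrank ℂ W ≤ 1 := by
      have := finrank_span_le_card (R := ℂ) ({e} : Set (EuclideanSpace ℂ (Fin n)))
      simpa using this
    rw [h2, finrank_top] at h3
    simp at h3; omega
  have hW0 : ν (W.restrictScalars ℝ : Set (EuclideanSpace ℂ (Fin n))) = 0 :=
    Measure.addHaar_submodule ν _ hWtop
  have hWm : MeasurableSet (W : Set (EuclideanSpace ℂ (Fin n))) :=
    (Submodule.closed_of_finiteDimensional W).measurableSet
  let L : ℂ →ₗ[ℝ] (EuclideanSpace ℂ (Fin n)) := (LinearMap.toSpanSingleton ℂ _ e).restrictScalars ℝ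
  have hs : MeasurableSet (T \ (W : Set (EuclideanSpace ℂ (Fin n))))ᶜ := (hT.diff hWm).compl
  have key := MeasureTheory.ae_mem_of_ae_add_linearMap_mem L volume ν hs (by
    intro y
    by_cases hy : y ∈ W
    · refine Filter.Eventually.of_forall fun x => ?_
      intro hx
      exact hx.2 (W.add_mem hy (W.smul_mem x (Submodule.mem_span_singleton_self e)))
    · rw [ae_iff]
      refine measure_mono_null ?_ (h y hy)
      intro x hx
      simp only [mem_setOf_eq, mem_compl_iff, not_not] at hx
      exact hx.1)
  rw [ae_iff] at key
  simp only [mem_compl_iff, not_not] at key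
  refine measure_mono_null (fun x hx => ?_) (measure_union_null key hW0)
  by_cases hxW : x ∈ W
  · exact Or.inr hxW
  · exact Or.inl ⟨hx, hxW⟩

end Dpart

noncomputable section D2part
lemma geom_slice {n : ℕ} {ξ z : EuclideanSpace ℂ (Fin n)} {l : ℂ} {ρ : ℝ} (hξ : ‖ξ‖ = 1)
    (hz : 1 ≤ ‖z‖) (hρ : 0 < ρ) (h : ‖l • ξ - z‖ ≤ ρ) :
    ‖l - inner ℂ ξ z‖ ≤ ρ ∧
      1 - ρ^2 ≤ ‖(inner ℂ ξ (((‖z‖:ℂ))⁻¹ • z) : ℂ)‖^2 := by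
  constructor
  · have h1 : l - inner ℂ ξ z = inner ℂ ξ (l • ξ - z) := by
      rw [inner_sub_right, inner_smul_right, inner_self_eq_norm_sq_to_K, hξ]; simp
    rw [h1]
    refine (norm_inner_le_norm ξ _).trans ?_
    rw [hξ, one_mul]; exact h
  · have h2 : ‖l • ξ - z‖^2 = ‖l‖^2 - 2 * ((starRingEnd ℂ) l * inner ℂ ξ z).re + ‖z‖^2 := by
      rw [norm_sub_sq (𝕜 := ℂ), norm_smul, hξ, inner_smul_left]; simp
    have h3 : ((starRingEnd ℂ) l * inner ℂ ξ z).re ≤ ‖l‖ * ‖(inner ℂ ξ z : ℂ)‖ := by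
      refine (Complex.re_le_norm _).trans ?_
      rw [norm_mul, RCLike.norm_conj]
    have h4 : ‖l • ξ - z‖^2 ≤ ρ^2 := by gcongr
    rw [inner_smul_right, norm_mul, norm_inv, Complex.norm_real, norm_norm, mul_pow, inv_pow]
    have h5 : 0 < ‖z‖^2 := by positivity
    rw [inv_mul_eq_div, le_div_iff₀ h5]
    nlinarith [sq_nonneg (‖l‖ - ‖(inner ℂ ξ z : ℂ)‖), mul_nonneg (sq_nonneg ρ) (show 0 ≤ ‖z‖^2-1 by nlinarith)]

lemma lemD2 {n : ℕ} (hn : 2 ≤ n) (μ : Measure (EuclideanSpace ℂ (Fin n))) [IsFiniteMeasure μ]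
    (hsupp : μ (unitSphere n)ᶜ = 0) (hpl : Pluri μ) {T : Set (EuclideanSpace ℂ (Fin n))}
    (hT : MeasurableSet T) (hc : ∀ z ∈ T, ∀ l : ℂ, l ≠ 0 → l • z ∈ T)
    (h0 : (μH[2 * (n:ℝ)] : Measure (EuclideanSpace ℂ (Fin n))) T = 0) : μ T = 0 := by
  let Q : Set ℂ := closedBall (3/2) (1/2)
  have hQ1 : ∀ l ∈ Q, 1 ≤ ‖l‖ := by
    intro l hl
    have h1 : ‖l - 3/2‖ ≤ 1/2 := by simpa [Q, dist_eq_norm] using hl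
    have h2 : ‖(3/2:ℂ)‖ = 3/2 := by norm_num
    have h3 := norm_sub_norm_le (3/2:ℂ) l
    rw [norm_sub_rev] at h3
    linarith
  have hQ0 : volume Q ≠ 0 := (measure_closedBall_pos volume _ (by norm_num)).ne'
  let ν : Measure ℂ := volume.restrict Q
  have hmeas : Measurable (fun p : EuclideanSpace ℂ (Fin n) × ℂ => p.2 • p.1) :=
    measurable_snd.smul measurable_fst
  let m := (μ.prod ν).map (fun p : EuclideanSpace ℂ (Fin n) × ℂ => p.2 • p.1)
  set K : ℝ := Real.pi * (2 * μ.real univ * Kn n) + 1 with hKdef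
  have hK : 0 < K := by
    have := Kn_pos n
    have := Real.pi_pos
    positivity
  have hdpos : (0:ℝ) < 2 * (n:ℝ) := by positivity
  have hA : MeasurableSet (T ∩ {z | 1 ≤ ‖z‖}) :=
    hT.inter (isClosed_le continuous_const continuous_norm).measurableSet
  have hL := lemL m hA (K := K) (d := 2 * (n:ℝ)) (ρ0 := 1) hK hdpos one_pos (by
    rintro z ⟨_, hz⟩ ρ hρ _
    simp only [mem_setOf_eq] at hz
    let ζ := ((‖z‖:ℂ))⁻¹ • z
    have hζ : ‖ζ‖ = 1 := by
      simp only [ζ, norm_smul, norm_inv, Complex.norm_real, norm_norm]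
      field_simp
    let Cap : Set (EuclideanSpace ℂ (Fin n)) := {ξ | 1-ρ^2 ≤ ‖(inner ℂ ξ ζ:ℂ)‖^2}
    have hCap : MeasurableSet Cap := by
      refine (isClosed_le continuous_const ?_).measurableSet
      fun_prop
    have hcap := cap_bound hn μ hsupp hpl ζ hζ hρ
    rw [Measure.map_apply hmeas measurableSet_closedBall,
      Measure.prod_apply (hmeas measurableSet_closedBall)]
    calc _ ≤ ∫⁻ ξ, Cap.indicator (fun _ => ENNReal.ofReal (Real.pi * ρ^2)) ξ ∂μ := by
          refine lintegral_mono_ae ?_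
          filter_upwards [ae_sphere hsupp] with ξ hξ
          by_cases hC : ξ ∈ Cap
          · rw [indicator_of_mem hC]
            calc _ ≤ volume (closedBall (inner ℂ ξ z : ℂ) ρ) := by
                  refine (Measure.restrict_apply_le _ _).trans (measure_mono ?_)
                  intro l hl
                  simp only [mem_preimage, mem_closedBall, dist_eq_norm] at hl ⊢
                  exact (geom_slice hξ hz hρ hl).1
              _ = _ := by
                  rw [Complex.volume_closedBall, mul_comm Real.pi, ENNReal.ofReal_mul (by positivity),
                    ENNReal.ofReal_pow hρ.le]
                  congr 1
                  exact (ENNReal.ofReal_coe_nnreal (p := NNReal.pi)).symm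
          · rw [indicator_of_notMem hC]
            rw [nonpos_iff_eq_zero]
            convert measure_empty (μ := ν)
            rw [eq_empty_iff_forall_notMem]
            intro l hl
            simp only [mem_preimage, mem_closedBall, dist_eq_norm] at hl
            exact hC (geom_slice hξ hz hρ hl).2
      _ = ENNReal.ofReal (Real.pi * ρ^2) * μ Cap := by
          rw [lintegral_indicator_const hCap]
      _ ≤ ENNReal.ofReal (Real.pi * ρ^2) * ENNReal.ofReal (2*μ.real univ*Kn n*ρ^(2*(n-1))) := by
          gcongr
          rw [← ofReal_measureReal]
          exact ENNReal.ofReal_le_ofReal hcap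
      _ ≤ _ := by
          rw [← ENNReal.ofReal_mul (by positivity)]
          apply ENNReal.ofReal_le_ofReal
          have e1 : ρ ^ (2 * (n:ℝ)) = ρ^2 * ρ^(2*(n-1)) := by
            rw [← pow_add, show 2 + 2*(n-1) = 2*n by omega, ← Real.rpow_natCast]; push_cast; rfl
          rw [e1, hKdef]
          have : 0 ≤ ρ^2 * ρ^(2*(n-1)) := by positivity
          nlinarith)
  have hz0 : m (T ∩ {z | 1 ≤ ‖z‖}) = 0 := by
    have : (μH[2 * (n:ℝ)] : Measure (EuclideanSpace ℂ (Fin n))) (T ∩ {z | 1 ≤ ‖z‖}) = 0 :=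
      measure_mono_null inter_subset_left h0
    rw [this, mul_zero] at hL
    exact nonpos_iff_eq_zero.1 hL
  rw [Measure.map_apply hmeas hA] at hz0
  have h5 : (μ.prod ν) ((T ∩ unitSphere n) ×ˢ Q) = 0 := by
    refine measure_mono_null ?_ hz0
    rintro ⟨ξ, l⟩ ⟨⟨h1, h2⟩, h3⟩
    have h4 := hQ1 l h3
    refine ⟨hc ξ h1 l ?_, ?_⟩
    · intro h; rw [h] at h4; simp at h4; linarith
    · have : ‖ξ‖ = 1 := by simpa [unitSphere] using h2
      simp only [mem_setOf_eq, norm_smul, this, mul_one]; exact h4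
  rw [Measure.prod_prod, mul_eq_zero] at h5
  have h6 : μ (T ∩ unitSphere n) = 0 := by
    rcases h5 with h | h
    · exact h
    · exfalso; apply hQ0; simpa [ν, Measure.restrict_apply_self] using h
  refine measure_mono_null (fun x hx => ?_) (measure_union_null h6 hsupp)
  by_cases h : x ∈ unitSphere n
  · exact Or.inl ⟨hx, h⟩
  · exact Or.inr h

end D2part

noncomputable section D4part
def phi {n : ℕ} (μ : Measure (EuclideanSpace ℂ (Fin n))) (ζ : EuclideanSpace ℂ (Fin n)) (τ : ℝ) : ℝ :=
  τ / (2 - τ) * (fF μ (((1 - τ : ℝ) : ℂ) • ζ)).re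

section
variable {n : ℕ} (hn : 2 ≤ n) (μ : Measure (EuclideanSpace ℂ (Fin n))) [IsFiniteMeasure μ]
    (hsupp : μ (unitSphere n)ᶜ = 0) (hpl : Pluri μ)
include hn hsupp hpl

lemma phi_mono {ζ : EuclideanSpace ℂ (Fin n)} (hζ : ‖ζ‖ = 1) {τ τ' : ℝ} (h0 : 0 < τ) (h1 : τ ≤ τ')
    (h2 : τ' ≤ 1) : phi μ ζ τ ≤ phi μ ζ τ' := by
  have h := (radial_harnack hn μ hsupp hpl ζ hζ (s := 1 - τ') (r := 1 - τ) (by linarith)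
    (by linarith) (by linarith)).2
  unfold phi
  rw [div_mul_eq_mul_div, div_mul_eq_mul_div, div_le_div_iff₀ (by linarith) (by linarith)]
  nlinarith

omit hn hpl in
lemma phi_contOn {τ : ℝ} (h0 : 0 < τ) (h2 : τ ≤ 1) :
    ContinuousOn (fun ζ => phi μ ζ τ) (unitSphere n) := by
  unfold phi
  refine ContinuousOn.mul continuousOn_const ?_
  refine Complex.continuous_re.comp_continuousOn ?_
  intro ζ hζ
  have hζ1 : ‖ζ‖ = 1 := by simpa [unitSphere] using hζ
  have hlt : ‖((1 - τ : ℝ) : ℂ) • ζ‖ < 1 := by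
    rw [norm_smul, hζ1, mul_one, Complex.norm_real, Real.norm_eq_abs, abs_lt]
    constructor <;> linarith
  have h1 := (fF_differentiableAt μ hsupp hlt).continuousAt
  have h3 : ContinuousAt (fun ζ : EuclideanSpace ℂ (Fin n) => ((1 - τ : ℝ) : ℂ) • ζ) ζ := by fun_prop
  exact (ContinuousAt.comp (f := fun ζ : EuclideanSpace ℂ (Fin n) => ((1 - τ : ℝ) : ℂ) • ζ)
    (g := fF μ) h1 h3).continuousWithinAt

lemma zero_part {E : Set (EuclideanSpace ℂ (Fin n))} (hEs : E ⊆ unitSphere n)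
    (hE : MeasurableSet E) (hfin : μH[2 * (n : ℝ) - 2] E < ⊤) :
    μ {ζ ∈ E | ∀ c > 0, ∃ τ, 0 < τ ∧ τ ≤ 1 ∧ phi μ ζ τ < c} = 0 := by
  set H := (μH[2 * (n : ℝ) - 2] : Measure (EuclideanSpace ℂ (Fin n))) E with hH
  have hn1 : (2:ℝ) ≤ n := by exact_mod_cast hn
  have hS : ∀ ζ ∈ E, ‖ζ‖ = 1 := fun ζ hζ => by simpa [unitSphere] using hEs hζ
  have hKn := Kn_pos n
  have main : ∀ δ : ℝ, 0 < δ → μ {ζ ∈ E | ∀ c > 0, ∃ τ, 0 < τ ∧ τ ≤ 1 ∧ phi μ ζ τ < c} ≤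
      ENNReal.ofReal (64 * Kn n * δ) * H := by
    intro δ hδ
    let A : ℕ → Set (EuclideanSpace ℂ (Fin n)) := fun k => E ∩ (unitSphere n ∩ {ζ | phi μ ζ (1/((k:ℝ)+1)) ≤ δ})
    have hτ1 : ∀ k : ℕ, 1/((k:ℝ)+1) ≤ 1 := by
      intro k
      rw [div_le_one (by positivity)]
      have : (0:ℝ) ≤ k := by positivity
      linarith
    have hA : ∀ k, MeasurableSet (A k) := by
      intro k
      refine hE.inter ?_
      exact ((phi_contOn μ hsupp (by positivity) (hτ1 k)).preimage_isClosed_of_isClosed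
        isClosed_sphere isClosed_Iic).measurableSet
    have hmono : Monotone A := by
      intro i j hij ζ hζ
      have h7 : phi μ ζ (1/((i:ℝ)+1)) ≤ δ := hζ.2.2
      refine ⟨hζ.1, hζ.2.1, ?_⟩
      show phi μ ζ (1/((j:ℝ)+1)) ≤ δ
      refine le_trans ?_ h7
      refine phi_mono hn μ hsupp hpl (hS ζ hζ.1) (by positivity) ?_ (hτ1 i)
      gcongr
    have hsub : {ζ ∈ E | ∀ c > 0, ∃ τ, 0 < τ ∧ τ ≤ 1 ∧ phi μ ζ τ < c} ⊆ ⋃ k, A k := by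
      rintro ζ ⟨hζ, h⟩
      obtain ⟨τ, h0, h1, h2⟩ := h δ hδ
      obtain ⟨k, hk⟩ := exists_nat_one_div_lt h0
      rw [mem_iUnion]
      exact ⟨k, hζ, hEs hζ, (phi_mono hn μ hsupp hpl (hS ζ hζ) (by positivity) hk.le h1).trans h2.le⟩
    refine (measure_mono hsub).trans ?_
    rw [hmono.measure_iUnion]
    refine iSup_le fun k => ?_
    set τ := 1/((k:ℝ)+1) with hτ
    have hτ0 : 0 < τ := by positivity
    have hL := lemL μ (hA k) (K := 64 * Kn n * δ) (d := 2 * (n:ℝ) - 2) (ρ0 := τ / (2*n)) (by positivity)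
      (by linarith) (by positivity) (by
        rintro ζ ⟨hζ, _, hp⟩ ρ hρ hρ0
        have hp' : phi μ ζ τ ≤ δ := hp
        have h3 : ρ * (2*n) ≤ τ := by rwa [le_div_iff₀ (by positivity)] at hρ0
        have h4 : ρ ≤ τ := by nlinarith
        have hb := ball_bound hn μ hsupp hpl ζ (hS ζ hζ) hτ0 (hτ1 k) hρ h4 (by
          nlinarith [hτ1 k])
        rw [← ofReal_measureReal]
        apply ENNReal.ofReal_le_ofReal
        refine hb.trans ?_
        have e1 : ρ ^ (2 * (n:ℝ) - 2) = ρ^(2*(n-1)) := by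
          rw [← Real.rpow_natCast]; push_cast [Nat.cast_sub (show 1 ≤ n by omega)]; ring_nf
        rw [e1]
        have e2 : τ*(fF μ (((1-τ:ℝ):ℂ)•ζ)).re ≤ 2 * δ := by
          unfold phi at hp'
          have h5 := hτ1 k
          rw [div_mul_eq_mul_div, div_le_iff₀ (by linarith)] at hp'
          nlinarith
        calc _ ≤ 32*Kn n*ρ^(2*(n-1)) * (2 * δ) := by gcongr
          _ = _ := by ring)
    refine hL.trans ?_
    exact mul_le_mul_right (measure_mono inter_subset_left) _
  have ht : Filter.Tendsto (fun δ : ℝ => ENNReal.ofReal (64 * Kn n * δ) * H) (𝓝[>] 0) (𝓝 0) := by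
    have : Filter.Tendsto (fun δ : ℝ => ENNReal.ofReal (64 * Kn n * δ)) (𝓝[>] 0) (𝓝 0) := by
      apply Filter.Tendsto.mono_left _ nhdsWithin_le_nhds
      have hc : Continuous (fun δ : ℝ => ENNReal.ofReal (64 * Kn n * δ)) := by
        exact ENNReal.continuous_ofReal.comp (by fun_prop)
      simpa using hc.tendsto 0
    simpa using ENNReal.Tendsto.mul_const this (Or.inr hfin.ne)
  refine nonpos_iff_eq_zero.1 (ge_of_tendsto ht ?_)
  filter_upwards [self_mem_nhdsWithin] with δ hδ
  exact main δ hδ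
end

end D4part

noncomputable section Fpart
lemma good_circle {B : Set ℂ} (hB : MeasurableSet B) {R ω : ℝ} (hR : 0 < R) (hω : 0 < ω)
    (h : volume (B ∩ closedBall 0 R) ≤ ENNReal.ofReal (ω * Real.pi * R^2 / 4)) :
    ∃ r, R/2 ≤ r ∧ r ≤ R ∧
      volume (Ioo (-Real.pi) Real.pi ∩ {θ | circleMap 0 r θ ∈ B}) ≤ ENNReal.ofReal (2*Real.pi*ω) := by
  by_contra hcon
  push Not at hcon
  have hpi := Real.pi_pos
  let W : Set (ℝ × ℝ) := (Ioc (R/2) R ×ˢ Ioo (-Real.pi) Real.pi) ∩ {p | circleMap 0 p.1 p.2 ∈ B}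
  have hcm : Measurable (fun p : ℝ × ℝ => circleMap 0 p.1 p.2) := by
    apply Continuous.measurable
    unfold circleMap
    fun_prop
  have hW : MeasurableSet W := (measurableSet_Ioc.prod measurableSet_Ioo).inter (hcm hB)
  have e1 : ENNReal.ofReal (R/2) * volume W ≤ volume (B ∩ closedBall 0 R) := by
    have hm : MeasurableSet (B ∩ closedBall (0:ℂ) R) := hB.inter measurableSet_closedBall
    rw [← lintegral_indicator_one hm, ← Complex.lintegral_comp_polarCoord_symm]
    have hsub : W ⊆ polarCoord.target := by
      rintro ⟨r, θ⟩ ⟨⟨h1, h2⟩, _⟩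
      rw [polarCoord_target]
      simp only at h1 h2
      exact ⟨by simp only [mem_Ioi]; linarith [h1.1], h2⟩
    refine le_trans ?_ (lintegral_mono_set hsub)
    rw [← setLIntegral_const]
    refine setLIntegral_mono' hW ?_
    rintro ⟨r, θ⟩ ⟨⟨h1, h2⟩, h3⟩
    simp only at h1 h2
    have h3' : circleMap 0 r θ ∈ B := h3
    have h4 : Complex.polarCoord.symm (r, θ) = circleMap 0 r θ := by
      rw [Complex.polarCoord_symm_apply, circleMap, Complex.exp_mul_I]; simp
    have h5 : circleMap 0 r θ ∈ B ∩ closedBall 0 R := ⟨h3', by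
      rw [mem_closedBall, dist_zero_right, norm_circleMap_zero, abs_of_nonneg (by linarith [h1.1])]; exact h1.2⟩
    rw [h4, indicator_of_mem h5]
    simp only [Pi.one_apply, smul_eq_mul, mul_one]
    exact ENNReal.ofReal_le_ofReal h1.1.le
  have e2 : ENNReal.ofReal (2*Real.pi*ω) * ENNReal.ofReal (R/2) ≤ volume W := by
    rw [Measure.volume_eq_prod, Measure.prod_apply hW]
    have hI : volume (Ioc (R/2) R) = ENNReal.ofReal (R/2) := by rw [Real.volume_Ioc]; congr 1; ring
    rw [← hI, ← setLIntegral_const]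
    refine le_trans ?_ (setLIntegral_le_lintegral (Ioc (R/2) R) _)
    refine setLIntegral_mono' measurableSet_Ioc ?_
    intro r hr
    refine (hcon r hr.1.le hr.2).le.trans (measure_mono ?_)
    rintro θ ⟨h1, h2⟩
    exact ⟨⟨hr, h1⟩, h2⟩
  have e3 : ENNReal.ofReal (R/2) * (ENNReal.ofReal (2*Real.pi*ω) * ENNReal.ofReal (R/2)) ≤
      ENNReal.ofReal (ω * Real.pi * R^2 / 4) := (mul_le_mul_right e2 _).trans (e1.trans h)
  rw [← ENNReal.ofReal_mul (by positivity), ← ENNReal.ofReal_mul (by positivity),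
    ENNReal.ofReal_le_ofReal_iff (by positivity)] at e3
  have : 0 < ω * Real.pi * R^2 := by positivity
  nlinarith

lemma mean_lower {G : ℂ → ℂ} {R : ℝ} (hR : 0 < R) (hG : DifferentiableOn ℂ G (ball 0 (2*R)))
    (hpos : ∀ h, ‖h‖ < 2 * R → 0 ≤ (G h).re) {B : Set ℂ} (hB : MeasurableSet B) {ω m : ℝ}
    (hω : 0 < ω) (hm : 0 ≤ m)
    (h : volume (B ∩ closedBall 0 R) ≤ ENNReal.ofReal (ω * Real.pi * R^2 / 4))
    (hlow : ∀ h, h ∉ B → R/2 ≤ ‖h‖ → ‖h‖ ≤ R → m ≤ (G h).re) :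
    (1 - ω) * m ≤ (G 0).re := by
  have hpi := Real.pi_pos
  obtain ⟨r, hr1, hr2, hr3⟩ := good_circle hB hR hω h
  have hr0 : 0 < r := by linarith
  have hcont : ContinuousOn G (ball 0 (2*R)) := hG.continuousOn
  have hd : DiffContOnCl ℂ G (ball 0 |r|) := by
    rw [abs_of_pos hr0]
    refine DifferentiableOn.diffContOnCl_ball (U := ball 0 (2*R)) hG ?_
    exact closedBall_subset_ball (by linarith)
  have h1 := hd.circleAverage
  rw [Real.circleAverage_eq_integral_add (-Real.pi), intervalIntegral.integral_comp_add_right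
    (fun θ => G (circleMap 0 r θ))] at h1
  rw [show (0:ℝ) + -Real.pi = -Real.pi by ring, show 2 * Real.pi + -Real.pi = Real.pi by ring] at h1
  have hc2 : Continuous (fun θ => G (circleMap 0 r θ)) := by
    refine hcont.comp_continuous (continuous_circleMap 0 r) ?_
    intro θ
    rw [mem_ball, dist_zero_right, norm_circleMap_zero, abs_of_pos hr0]; linarith
  have h2 : (G 0).re = (2*Real.pi)⁻¹ * ∫ θ in (-Real.pi)..Real.pi, (G (circleMap 0 r θ)).re := by
    rw [← h1]
    rw [Complex.smul_re, smul_eq_mul]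
    congr 1
    have := Complex.reCLM.intervalIntegral_comp_comm (hc2.intervalIntegrable (μ := volume) (-Real.pi) Real.pi)
    simpa using this.symm
  rw [h2, intervalIntegral.integral_of_le (by linarith), integral_Ioc_eq_integral_Ioo]
  let Gd : Set ℝ := Ioo (-Real.pi) Real.pi ∩ {θ | circleMap 0 r θ ∈ B}ᶜ
  have hmB : MeasurableSet {θ | circleMap 0 r θ ∈ B} := (continuous_circleMap 0 r).measurable hB
  have hGdm : MeasurableSet Gd := measurableSet_Ioo.inter hmB.compl
  have hvol : (2*Real.pi) * (1 - ω) ≤ volume.real Gd := by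
    have hh := measureReal_inter_add_diff (μ := volume) (s := Ioo (-Real.pi) Real.pi) hmB (by
      rw [Real.volume_Ioo]; exact ENNReal.ofReal_ne_top)
    rw [measureReal_def (s := Ioo (-Real.pi) Real.pi), Real.volume_Ioo, ENNReal.toReal_ofReal (by linarith)] at hh
    have : volume.real (Ioo (-Real.pi) Real.pi ∩ {θ | circleMap 0 r θ ∈ B}) ≤ 2*Real.pi*ω :=
      ENNReal.toReal_le_of_le_ofReal (by positivity) hr3
    have e : volume.real Gd = volume.real (Ioo (-Real.pi) Real.pi \ {θ | circleMap 0 r θ ∈ B}) := by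
      rw [diff_eq]
    rw [e]; nlinarith
  have hint : IntegrableOn (fun θ => (G (circleMap 0 r θ)).re) (Ioo (-Real.pi) Real.pi) :=
    ((Complex.continuous_re.comp hc2).integrableOn_Icc).mono_set Ioo_subset_Icc_self
  have h3 : m * volume.real Gd ≤ ∫ θ in Ioo (-Real.pi) Real.pi, (G (circleMap 0 r θ)).re := by
    calc m * volume.real Gd = ∫ θ in Gd, m := by simp [mul_comm]
      _ ≤ ∫ θ in Gd, (G (circleMap 0 r θ)).re := by
          refine setIntegral_mono_on ?_ (hint.mono_set inter_subset_left) hGdm ?_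
          · refine integrableOn_const (ne_top_of_le_ne_top ?_ (measure_mono inter_subset_left))
            rw [Real.volume_Ioo]; exact ENNReal.ofReal_ne_top
          · rintro θ ⟨_, hθ⟩
            refine hlow _ hθ ?_ ?_ <;> rw [norm_circleMap_zero, abs_of_pos hr0] <;> assumption
      _ ≤ _ := by
          refine setIntegral_mono_set hint ?_ (Filter.Eventually.of_forall inter_subset_left)
          refine Filter.Eventually.of_forall fun θ => ?_
          refine hpos _ ?_
          rw [norm_circleMap_zero, abs_of_pos hr0]; linarith
  rw [inv_mul_eq_div, le_div_iff₀ (by positivity)]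
  nlinarith [mul_le_mul_of_nonneg_left hvol hm]

end Fpart

noncomputable section F2part
lemma julia {f : ℂ → ℂ} (hd : DifferentiableOn ℂ f (ball 0 1))
    (hp : ∀ z ∈ ball (0:ℂ) 1, 0 ≤ (f z).re) {c : ℝ}
    (h : ∀ r : ℝ, 0 < r → r < 1 → c * (1 + r) ≤ (f (r:ℂ)).re * (1 - r)) {w : ℂ} (hw : ‖w‖ < 1) :
    c * (1 - ‖w‖^2) ≤ (f w).re * ‖1 - w‖^2 := by
  have hfw : 0 ≤ (f w).re := hp w (by simpa using hw)
  have hw2 : 0 < 1 - ‖w‖^2 := by nlinarith [norm_nonneg w]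
  have main : ∀ r : ℝ, 0 < r → r < 1 → c * (1+r)^2 * (1 - ‖w‖^2) ≤
      (f w).re * (‖1 - (starRingEnd ℂ) w * (r:ℂ)‖ + ‖(r:ℂ) - w‖)^2 := by
    intro r h0 h1
    have hr : ‖(r:ℂ)‖ = r := by rw [Complex.norm_real, Real.norm_of_nonneg h0.le]
    have a := harnack2 hd hp (z := (r:ℂ)) (w := w) (by rw [hr]; exact h1) hw
    have b := normSq_identity (r:ℂ) w
    rw [hr] at b
    set A := ‖1 - (starRingEnd ℂ) w * (r:ℂ)‖
    set D := ‖(r:ℂ) - w‖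
    have hAD : 0 ≤ A + D := add_nonneg (norm_nonneg _) (norm_nonneg _)
    have h2 := mul_le_mul_of_nonneg_right a hAD
    have h3 : (f (r:ℂ)).re * (A - D) * (A + D) = (f (r:ℂ)).re * ((1 - r^2)*(1 - ‖w‖^2)) := by
      rw [← b]; ring
    rw [h3] at h2
    have h4 := mul_le_mul_of_nonneg_right (h r h0 h1) (show 0 ≤ (1+r) * (1 - ‖w‖^2) by positivity)
    nlinarith
  have t1 : Filter.Tendsto (fun r : ℝ => c * (1+r)^2 * (1 - ‖w‖^2)) (𝓝[<] 1) (𝓝 (c * (1+1)^2 * (1 - ‖w‖^2))) := by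
    apply Filter.Tendsto.mono_left _ nhdsWithin_le_nhds
    exact Continuous.tendsto (f := fun r : ℝ => c * (1+r)^2 * (1 - ‖w‖^2)) (by fun_prop) 1
  have t2 : Filter.Tendsto (fun r : ℝ => (f w).re * (‖1 - (starRingEnd ℂ) w * (r:ℂ)‖ + ‖(r:ℂ) - w‖)^2) (𝓝[<] 1)
      (𝓝 ((f w).re * (‖1 - (starRingEnd ℂ) w * ((1:ℝ):ℂ)‖ + ‖((1:ℝ):ℂ) - w‖)^2)) := by
    apply Filter.Tendsto.mono_left _ nhdsWithin_le_nhds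
    exact Continuous.tendsto (f := fun r : ℝ => (f w).re * (‖1 - (starRingEnd ℂ) w * (r:ℂ)‖ + ‖(r:ℂ) - w‖)^2)
      (by fun_prop) 1
  have t3 := le_of_tendsto_of_tendsto t1 t2 (by
    filter_upwards [Ioo_mem_nhdsLT (show (0:ℝ) < 1 by norm_num)] with r hr
    exact main r hr.1 hr.2)
  have e : ‖1 - (starRingEnd ℂ) w * ((1:ℝ):ℂ)‖ = ‖1 - w‖ := by
    rw [← RCLike.norm_conj (1 - w)]; simp
  rw [e, Complex.ofReal_one] at t3
  nlinarith

lemma gfun {f : ℂ → ℂ} (hd : DifferentiableOn ℂ f (ball 0 1))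
    (hp : ∀ z ∈ ball (0:ℂ) 1, 0 ≤ (f z).re) {c : ℝ}
    (h : ∀ r : ℝ, 0 < r → r < 1 → c * (1 + r) ≤ (f (r:ℂ)).re * (1 - r)) :
    DifferentiableOn ℂ (fun w => f w - c * ((1+w)/(1-w))) (ball 0 1) ∧
    ∀ w ∈ ball (0:ℂ) 1, 0 ≤ (f w - c * ((1+w)/(1-w))).re := by
  have hne : ∀ w ∈ ball (0:ℂ) 1, (1:ℂ) - w ≠ 0 := by
    intro w hw h
    have : w = 1 := (sub_eq_zero.1 h).symm
    rw [this] at hw; simp at hw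
  constructor
  · refine hd.sub ?_
    intro w hw
    refine DifferentiableAt.differentiableWithinAt ?_
    have := hne w hw
    fun_prop (disch := assumption)
  · intro w hw
    have hw1 : ‖w‖ < 1 := by simpa using hw
    have hj := julia hd hp h hw1
    rw [Complex.sub_re, Complex.re_ofReal_mul, re_kernel hw1]
    have : 0 < ‖1 - w‖^2 := by have := norm_pos_iff.2 (hne w hw); positivity
    rw [← mul_div_assoc, sub_nonneg, div_le_iff₀ this]
    exact hj

end F2part

noncomputable section G1part
lemma norm_one_sub_sq (w : ℂ) : ‖1 - w‖^2 = (1 - ‖w‖)^2 + 2 * (‖w‖ - w.re) := by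
  rw [← Complex.normSq_eq_norm_sq, Complex.normSq_apply]
  have h : ‖w‖^2 = w.re*w.re + w.im*w.im := by rw [← Complex.normSq_eq_norm_sq, Complex.normSq_apply]
  simp only [Complex.sub_re, Complex.one_re, Complex.sub_im, Complex.one_im]
  nlinarith

/-- pure real-number part of step 3 -/
lemma num_step {s d : ℝ} (hs : 0 < s) (h1 : 400000 * s - s ≤ d) (h2 : d ≤ 400000 * s - s/40) :
    (1 + 1/(80*400000)) * (d^2 + 2048 * s^2) ≤ d * (400000 * s) := by
  nlinarith [mul_nonneg (sub_nonneg.2 h1) (sub_nonneg.2 h2), mul_pos hs hs]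

set_option maxHeartbeats 2000000 in
lemma good_pt {f : ℂ → ℂ} (hd : DifferentiableOn ℂ f (ball 0 1))
    (hp : ∀ z ∈ ball (0:ℂ) 1, 0 ≤ (f z).re) {c τ s q κ : ℝ} (hc : 0 < c)
    (hj : ∀ r : ℝ, 0 < r → r < 1 → c * (1 + r) ≤ (f (r:ℂ)).re * (1 - r))
    (hτ : 0 < τ) (hτ1 : τ ≤ 1)
    (hfτ : (f ((1-τ:ℝ):ℂ)).re * τ ≤ c * (1 + 1/(400*400000)) * (2 - τ))
    (hs : 0 < s) (hsL : 400000 * s ≤ 1/100) (hq1 : s/8 ≤ q) (hq2 : q ≤ 2*s) {w1 w : ℂ}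
    (hw1 : ‖w1‖^2 = (1-16*s)^2*(1+q)) (hw : ‖w‖^2 = (1-400000*s)^2*(1+q))
    (hκ0 : 0 < κ) (hκ1 : κ ≤ 1) (hκ : w = κ * w1) (hclose : ‖1 - w1‖ ≤ τ/4)
    (hU : c ≤ (f w1).re * (32 * s)) :
    c * ((2 - 400000*s)/(400000*s)) * (1 + 1/(80*400000)) ≤ (f w).re := by
  have hn1 := norm_nonneg w1
  have hn := norm_nonneg w
  -- size of w1
  have a1 : 28 * s ≤ 1 - ‖w1‖^2 := by rw [hw1]; nlinarith [mul_pos hs hs, mul_pos (mul_pos hs hs) hs]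
  have a2 : 1 - ‖w1‖^2 ≤ 32 * s := by rw [hw1]; nlinarith [sq_nonneg (1-16*s), mul_pos hs hs]
  have a3 : ‖w1‖ < 1 := by nlinarith
  -- size of w
  have hsq : (0:ℝ) ≤ 1 - 400000 * s := by linarith
  have b1 : ‖w‖ ≤ (1-400000*s)*(1+s) := by
    apply le_of_sq_le_sq _ (by positivity)
    rw [hw, mul_pow]
    gcongr
    nlinarith [sq_nonneg s]
  have b2 : (1-400000*s)*(1+s/24) ≤ ‖w‖ := by
    apply le_of_sq_le_sq _ hn
    rw [hw, mul_pow]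
    gcongr
    nlinarith [sq_nonneg s]
  set d := 1 - ‖w‖ with hdd
  have b3 : 400000 * s - s ≤ d := by nlinarith [mul_pos hs hs]
  have b4 : d ≤ 400000 * s - s/40 := by nlinarith
  have b5 : ‖w‖ < 1 := by linarith
  -- step 2
  obtain ⟨gd, gp⟩ := gfun hd hp hj
  have hz : ‖((1-τ:ℝ):ℂ)‖ = 1 - τ := by rw [Complex.norm_real, Real.norm_of_nonneg (by linarith)]
  have hh := harnack4 gd gp (z := w1) (w := ((1-τ:ℝ):ℂ)) a3 (by rw [hz]; linarith)
  have hgτ : (f ((1-τ:ℝ):ℂ) - c * ((1+((1-τ:ℝ):ℂ))/(1-((1-τ:ℝ):ℂ)))).re * τ ≤ c * (1/(400*400000)) * (2-τ) := by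
    have : ((1+((1-τ:ℝ):ℂ))/(1-((1-τ:ℝ):ℂ))) = (((2-τ)/τ : ℝ) : ℂ) := by push_cast; ring_nf
    rw [this, Complex.sub_re, ← Complex.ofReal_mul, Complex.ofReal_re, sub_mul]
    have e : c * ((2-τ)/τ) * τ = c * (2 - τ) := by field_simp
    rw [e]; nlinarith
  rw [hz, Complex.conj_ofReal] at hh
  set g1 := (f w1 - c * ((1+w1)/(1-w1))).re with hg1
  have hg1n : 0 ≤ g1 := gp w1 (by simpa using a3)
  set gτ := (f ((1-τ:ℝ):ℂ) - c * ((1+((1-τ:ℝ):ℂ))/(1-((1-τ:ℝ):ℂ)))).re with hgτd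
  have hgτn : 0 ≤ gτ := gp _ (by rw [mem_ball, dist_zero_right, hz]; linarith)
  have hD : ‖1 - ((1-τ:ℝ):ℂ) * w1‖ ≤ 5/4*τ := by
    have e : 1 - ((1-τ:ℝ):ℂ) * w1 = (1 - w1) + (τ:ℂ) * w1 := by push_cast; ring
    rw [e]
    refine (norm_add_le _ _).trans ?_
    rw [norm_mul, Complex.norm_real, Real.norm_of_nonneg hτ.le]
    have := mul_le_mul_of_nonneg_left a3.le hτ.le
    linarith
  have hD2 : ‖1 - ((1-τ:ℝ):ℂ) * w1‖^2 ≤ 25/16*τ^2 := by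
    have := pow_le_pow_left₀ (norm_nonneg _) hD 2
    nlinarith
  have c1 : g1 * (28*s) ≤ c * (1/(400*400000)) * (25/4) := by
    have e1 : g1 * ((28*s) * (1 - (1-τ)^2)) ≤ g1 * ((1 - ‖w1‖^2) * (1 - (1-τ)^2)) := by
      have : 0 ≤ 1 - (1-τ)^2 := by nlinarith
      gcongr
    have e2 : gτ * (4 * ‖1 - ((1-τ:ℝ):ℂ) * w1‖^2) ≤ gτ * (4 * (25/16*τ^2)) := by gcongr
    have e3 : gτ * (4 * (25/16*τ^2)) ≤ c * (1/(400*400000)) * (2-τ) * (25/4*τ) := by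
      have := mul_le_mul_of_nonneg_right hgτ (show 0 ≤ 25/4*τ by positivity)
      nlinarith
    have e4 : g1 * (28*s) * (τ*(2-τ)) ≤ c * (1/(400*400000)) * (25/4) * (τ*(2-τ)) := by nlinarith
    exact le_of_mul_le_mul_right e4 (by nlinarith)
  have hpos1 : 0 < ‖1 - w1‖^2 := by
    have : 1 - ‖w1‖ ≤ ‖1 - w1‖ := by simpa using norm_sub_norm_le (1:ℂ) w1
    have : 0 < ‖1 - w1‖ := by linarith
    positivity
  have c2 : ‖1 - w1‖^2 ≤ 2048 * s^2 := by
    have e1 : g1 = (f w1).re - c * ((1 - ‖w1‖^2)/‖1 - w1‖^2) := by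
      rw [hg1, Complex.sub_re, Complex.re_ofReal_mul, re_kernel a3]
    have e2 : c ≤ (g1 + c * ((1 - ‖w1‖^2)/‖1 - w1‖^2)) * (32 * s) := by rw [e1]; linarith
    have e3 : c/2 ≤ c * ((1 - ‖w1‖^2)/‖1 - w1‖^2) * (32 * s) := by nlinarith
    have e4 : 1/2 ≤ ((1 - ‖w1‖^2)/‖1 - w1‖^2) * (32*s) := by
      refine le_of_mul_le_mul_left ?_ hc
      linarith
    rw [div_mul_eq_mul_div, le_div_iff₀ hpos1] at e4
    nlinarith
  -- step 3
  have k1 := norm_one_sub_sq w1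
  have k2 := norm_one_sub_sq w
  have k3 : ‖w‖ = κ * ‖w1‖ := by rw [hκ, norm_mul, Complex.norm_real, Real.norm_of_nonneg hκ0.le]
  have k4 : w.re = κ * w1.re := by rw [hκ, Complex.re_ofReal_mul]
  have k5 : 0 ≤ ‖w1‖ - w1.re := sub_nonneg.2 (Complex.re_le_norm w1)
  have k6 : ‖1 - w‖^2 ≤ d^2 + 2048*s^2 := by
    rw [k2]
    have : ‖w‖ - w.re ≤ ‖w1‖ - w1.re := by
      rw [k3, k4, ← mul_sub]; exact mul_le_of_le_one_left k5 hκ1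
    have h7 := sq_nonneg (1 - ‖w1‖)
    linarith
  have hJ := julia hd hp hj b5
  have hposw : 0 < ‖1 - w‖^2 := by
    have : 1 - ‖w‖ ≤ ‖1 - w‖ := by simpa using norm_sub_norm_le (1:ℂ) w
    have : 0 < ‖1 - w‖ := by linarith
    positivity
  refine le_of_mul_le_mul_right ?_ hposw
  refine le_trans ?_ hJ
  have n1 := num_step hs b3 b4
  have hM : 0 ≤ c * ((2 - 400000*s)/(400000*s)) := by
    have : 0 ≤ 2 - 400000*s := by linarith
    positivity
  calc _ ≤ c * ((2 - 400000*s)/(400000*s)) * (1 + 1/(80*400000)) * (d^2 + 2048*s^2) := by gcongr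
    _ = c * ((2 - 400000*s)/(400000*s)) * ((1 + 1/(80*400000)) * (d^2 + 2048*s^2)) := by ring
    _ ≤ c * ((2 - 400000*s)/(400000*s)) * (d * (400000 * s)) := by gcongr
    _ = c * ((2 - 400000*s) * d) := by field_simp
    _ ≤ _ := by
      gcongr
      have : ‖w‖ = 1 - d := by rw [hdd]; ring
      rw [this]; nlinarith

end G1part

noncomputable section G2part
def PP {n : ℕ} (ζ0 e0 : EuclideanSpace ℂ (Fin n)) (t : ℝ) (h : ℂ) : EuclideanSpace ℂ (Fin n) :=
  (((1-t:ℝ):ℂ) * (1 + inner ℂ ζ0 e0 * h)⁻¹) • (ζ0 + h • e0)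

lemma PP_zero {n : ℕ} (ζ0 e0 : EuclideanSpace ℂ (Fin n)) (t : ℝ) :
    PP ζ0 e0 t 0 = ((1-t:ℝ):ℂ) • ζ0 := by simp [PP]

section
variable {n : ℕ} {ζ0 e0 : EuclideanSpace ℂ (Fin n)} (hζ0 : ‖ζ0‖ = 1)
include hζ0

lemma inner_e' : inner ℂ ζ0 (e0 - (inner ℂ ζ0 e0 : ℂ) • ζ0) = 0 := by
  rw [inner_sub_right, inner_smul_right, inner_self_eq_norm_sq_to_K, hζ0]; simp

lemma PP_eq {t : ℝ} {h : ℂ} (hne : 1 + inner ℂ ζ0 e0 * h ≠ 0) :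
    PP ζ0 e0 t h = ((1-t:ℝ):ℂ) • (ζ0 + (h / (1 + inner ℂ ζ0 e0 * h)) • (e0 - (inner ℂ ζ0 e0 : ℂ) • ζ0)) := by
  unfold PP
  set α : ℂ := inner ℂ ζ0 e0
  rw [mul_smul]
  congr 1
  have : ζ0 + h • e0 = (1 + α * h) • ζ0 + h • (e0 - α • ζ0) := by module
  rw [this, smul_add, smul_smul, smul_smul, inv_mul_cancel₀ hne, one_smul, div_eq_inv_mul]

lemma PP_norm {t : ℝ} {h : ℂ} (hne : 1 + inner ℂ ζ0 e0 * h ≠ 0) :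
    ‖PP ζ0 e0 t h‖^2 = (1-t)^2 * (1 + ‖e0 - (inner ℂ ζ0 e0 : ℂ) • ζ0‖^2 * ‖h‖^2 / ‖1 + inner ℂ ζ0 e0 * h‖^2) := by
  rw [PP_eq hζ0 hne, norm_smul, mul_pow, Complex.norm_real, Real.norm_eq_abs, sq_abs]
  congr 1
  rw [norm_add_sq (𝕜 := ℂ), inner_smul_right, inner_e' hζ0, hζ0, norm_smul, norm_div]
  simp
  ring

omit hζ0 in
lemma one_add_bounds {α h : ℂ} {R : ℝ} (h1 : ‖α‖ * (2*R) ≤ 1/4) (hh : ‖h‖ ≤ 2*R) :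
    3/4 ≤ ‖1 + α * h‖ ∧ ‖1 + α*h‖ ≤ 5/4 := by
  have h2 : ‖α * h‖ ≤ 1/4 := by
    rw [norm_mul]; exact (mul_le_mul_of_nonneg_left hh (norm_nonneg _)).trans h1
  constructor
  · have := norm_sub_norm_le (1:ℂ) (-(α*h))
    simp only [norm_neg, norm_one, sub_neg_eq_add] at this
    linarith
  · have := norm_add_le (1:ℂ) (α*h)
    simp only [norm_one] at this
    linarith

lemma PP_lt_one {R t : ℝ} (hR : 0 < R) (h1 : ‖(inner ℂ ζ0 e0 : ℂ)‖ * (2*R) ≤ 1/4)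
    (hβ : 0 < ‖e0 - (inner ℂ ζ0 e0 : ℂ) • ζ0‖)
    (hs : ‖e0 - (inner ℂ ζ0 e0 : ℂ) • ζ0‖^2 * R^2 ≤ 1/100)
    (ht : 16 * (‖e0 - (inner ℂ ζ0 e0 : ℂ) • ζ0‖^2 * R^2) ≤ t) (ht1 : t ≤ 1) {h : ℂ} (hh : ‖h‖ ≤ 2*R) :
    ‖PP ζ0 e0 t h‖ < 1 := by
  obtain ⟨b1, b2⟩ := one_add_bounds h1 hh
  have hne : 1 + inner ℂ ζ0 e0 * h ≠ 0 := by rw [← norm_pos_iff]; linarith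
  have hN := PP_norm hζ0 (t := t) hne
  set b := ‖e0 - (inner ℂ ζ0 e0 : ℂ) • ζ0‖
  set N := ‖1 + inner ℂ ζ0 e0 * h‖
  set s := b^2 * R^2 with hsdef
  have hs0 : 0 < s := by positivity
  have hq : b^2*‖h‖^2/N^2 ≤ 8 * s := by
    rw [div_le_iff₀ (by positivity)]
    have : ‖h‖^2 ≤ (2*R)^2 := by gcongr
    calc b^2*‖h‖^2 ≤ b^2 * (2*R)^2 := by gcongr
      _ = 8 * s * (1/2) := by rw [hsdef]; ring
      _ ≤ 8 * s * N^2 := by gcongr; nlinarith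
  have h3 : (1-t)^2 ≤ (1-16*s)^2 := by
    apply pow_le_pow_left₀ <;> linarith
  have h4 : ‖PP ζ0 e0 t h‖^2 < 1 := by
    rw [hN]
    calc _ ≤ (1-16*s)^2 * (1 + 8*s) := by gcongr
      _ < 1 := by nlinarith [mul_pos hs0 hs0, mul_pos (mul_pos hs0 hs0) hs0]
  nlinarith [norm_nonneg (PP ζ0 e0 t h)]

lemma PP_dist {R t : ℝ} (hR : 0 < R) (h1 : ‖(inner ℂ ζ0 e0 : ℂ)‖ * (2*R) ≤ 1/4)
    (ht : 0 ≤ t) (ht1 : t ≤ 1) {h : ℂ} (hh : ‖h‖ ≤ R) :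
    ‖PP ζ0 e0 t h - ζ0‖ ≤ t + 2 * R * ‖e0 - (inner ℂ ζ0 e0 : ℂ) • ζ0‖ := by
  obtain ⟨b1, b2⟩ := one_add_bounds h1 (show ‖h‖ ≤ 2 * R by linarith)
  have hne : 1 + inner ℂ ζ0 e0 * h ≠ 0 := by rw [← norm_pos_iff]; linarith
  rw [PP_eq hζ0 hne]
  set e' := e0 - (inner ℂ ζ0 e0 : ℂ) • ζ0
  set N := 1 + inner ℂ ζ0 e0 * h
  have e : ((1-t:ℝ):ℂ) • (ζ0 + (h/N) • e') - ζ0 = (-(t:ℂ)) • ζ0 + (((1-t:ℝ):ℂ) * (h/N)) • e' := by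
    push_cast; module
  rw [e]
  refine (norm_add_le _ _).trans ?_
  rw [norm_smul, norm_smul, norm_neg, norm_mul, Complex.norm_real, Complex.norm_real, hζ0, norm_div,
    Real.norm_of_nonneg ht, Real.norm_of_nonneg (show 0 ≤ 1 - t by linarith), mul_one]
  have h5 : ‖h‖/‖N‖ ≤ 2 * R := by
    rw [div_le_iff₀ (by linarith)]; nlinarith
  have h6 : (1 - t) * (‖h‖/‖N‖) ≤ 2 * R := by
    refine le_trans (mul_le_of_le_one_left (by positivity) (by linarith)) h5
  gcongr

omit hζ0 in
lemma PP_diff {R t : ℝ} (h1 : ‖(inner ℂ ζ0 e0 : ℂ)‖ * (2*R) ≤ 1/4) {h : ℂ} (hh : ‖h‖ ≤ 2*R) :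
    DifferentiableAt ℂ (PP ζ0 e0 t) h := by
  obtain ⟨b1, b2⟩ := one_add_bounds h1 hh
  have hne : 1 + inner ℂ ζ0 e0 * h ≠ 0 := by rw [← norm_pos_iff]; linarith
  unfold PP
  fun_prop (disch := assumption)
end

end G2part

noncomputable section G3part
def Piece {n : ℕ} (μ : Measure (EuclideanSpace ℂ (Fin n))) (c τ : ℝ) (z0 : EuclideanSpace ℂ (Fin n)) :
    Set (EuclideanSpace ℂ (Fin n)) :=
  {ζ | ζ ∈ unitSphere n ∧ (∀ r, 0 < r → r < 1 → c ≤ phi μ ζ r) ∧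
    phi μ ζ τ ≤ c * (1 + 1/(400*400000)) ∧ ζ ∈ closedBall z0 (τ/16)}

lemma le_phi {n : ℕ} {μ : Measure (EuclideanSpace ℂ (Fin n))} {ζ : EuclideanSpace ℂ (Fin n)}
    {c r : ℝ} (h1 : r < 1) (h : c ≤ phi μ ζ r) :
    c * (2 - r) ≤ (fF μ (((1 - r : ℝ) : ℂ) • ζ)).re * r := by
  unfold phi at h
  rw [div_mul_eq_mul_div, le_div_iff₀ (by linarith)] at h
  linarith

lemma phi_le {n : ℕ} {μ : Measure (EuclideanSpace ℂ (Fin n))} {ζ : EuclideanSpace ℂ (Fin n)}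
    {c r : ℝ} (h1 : r ≤ 1) (h : phi μ ζ r ≤ c) :
    (fF μ (((1 - r : ℝ) : ℂ) • ζ)).re * r ≤ c * (2 - r) := by
  unfold phi at h
  rw [div_mul_eq_mul_div, div_le_iff₀ (by linarith)] at h
  linarith

section
variable {n : ℕ} (hn : 2 ≤ n) (μ : Measure (EuclideanSpace ℂ (Fin n))) [IsFiniteMeasure μ]
    (hsupp : μ (unitSphere n)ᶜ = 0) (hpl : Pluri μ)
include hn hsupp hpl

/-- lower bound at a good point -/
lemma good_lower {c τ R : ℝ} {z0 ζ0 e0 : EuclideanSpace ℂ (Fin n)} (hc : 0 < c) (hτ : 0 < τ) (hτ1 : τ ≤ 1)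
    (hP : ζ0 ∈ Piece μ c τ z0) {s : ℝ} (hs : s = ‖e0 - (inner ℂ ζ0 e0 : ℂ) • ζ0‖^2 * R^2)
    (hβ : 0 < ‖e0 - (inner ℂ ζ0 e0 : ℂ) • ζ0‖) (hR : 0 < R)
    (h1 : ‖(inner ℂ ζ0 e0 : ℂ)‖ * (2*R) ≤ 1/4) (hsL : 400000 * s ≤ 1/100)
    (h3 : 16 * s + 2 * R * ‖e0 - (inner ℂ ζ0 e0 : ℂ) • ζ0‖ ≤ τ/8)
    {h l : ℂ} (hh1 : R/2 ≤ ‖h‖) (hh2 : ‖h‖ ≤ R) {ζ : EuclideanSpace ℂ (Fin n)} (hζ : ζ ∈ Piece μ c τ z0)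
    (hl : ζ0 + h • e0 = l • ζ) :
    c * ((2 - 400000*s)/(400000*s)) * (1 + 1/(80*400000)) ≤ (fF μ (PP ζ0 e0 (400000*s) h)).re := by
  have hζ0 : ‖ζ0‖ = 1 := by simpa [unitSphere] using hP.1
  have hζ1 : ‖ζ‖ = 1 := by simpa [unitSphere] using hζ.1
  obtain ⟨b1, b2⟩ := one_add_bounds h1 (show ‖h‖ ≤ 2 * R by linarith)
  have hne : 1 + inner ℂ ζ0 e0 * h ≠ 0 := by rw [← norm_pos_iff]; linarith
  have hs0 : 0 < s := by rw [hs]; positivity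
  let A : ℝ → ℂ := fun t => ((1-t:ℝ):ℂ) * (1 + inner ℂ ζ0 e0 * h)⁻¹ * l
  have hA : ∀ t, PP ζ0 e0 t h = A t • ζ := by
    intro t; simp only [PP, A, hl, smul_smul]
  have hAn : ∀ t, ‖A t‖ = ‖PP ζ0 e0 t h‖ := by
    intro t; rw [hA, norm_smul, hζ1, mul_one]
  set q := ‖e0 - (inner ℂ ζ0 e0 : ℂ) • ζ0‖^2 * ‖h‖^2 / ‖1 + inner ℂ ζ0 e0 * h‖^2 with hq
  have hAq : ∀ t, ‖A t‖^2 = (1-t)^2*(1+q) := by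
    intro t; rw [hAn, PP_norm hζ0 hne]
  have hq1 : s/8 ≤ q := by
    rw [hq, le_div_iff₀ (by positivity), hs]
    calc _ = ‖e0 - (inner ℂ ζ0 e0 : ℂ) • ζ0‖^2 * ((R/2)^2 * (‖1 + inner ℂ ζ0 e0 * h‖^2/2)) := by ring
      _ ≤ ‖e0 - (inner ℂ ζ0 e0 : ℂ) • ζ0‖^2 * (‖h‖^2 * 1) := by gcongr; nlinarith
      _ = _ := by ring
  have hq2 : q ≤ 2 * s := by
    rw [hq, div_le_iff₀ (by positivity), hs]
    calc _ ≤ ‖e0 - (inner ℂ ζ0 e0 : ℂ) • ζ0‖^2 * (R^2 * 1) := by rw [mul_one]; gcongr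
      _ ≤ ‖e0 - (inner ℂ ζ0 e0 : ℂ) • ζ0‖^2 * (R^2 * (2 * ‖1 + inner ℂ ζ0 e0 * h‖^2)) := by gcongr; nlinarith
      _ = _ := by ring
  have hsd := slice_diff hn μ hsupp ζ hζ1
  have hsn := slice_nonneg hn μ hsupp hpl ζ hζ1
  rw [hA]
  refine good_pt (f := fun l : ℂ => fF μ (l • ζ)) hsd hsn (q := q) (w1 := A (16*s))
    (κ := (1-400000*s)/(1-16*s)) hc ?_ hτ hτ1 ?_ hs0 hsL hq1 hq2 (hAq _) (hAq _) ?_ ?_ ?_ ?_ ?_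
  · intro r hr0 hr1
    have := le_phi (by linarith) (hζ.2.1 (1-r) (by linarith) (by linarith))
    rw [show 1 - (1 - r) = r by ring] at this
    linarith
  · exact phi_le hτ1 hζ.2.2.1
  · apply div_pos <;> linarith
  · rw [div_le_one (by linarith)]; linarith
  · simp only [A]
    have : ((1-16*s:ℝ):ℂ) ≠ 0 := by exact_mod_cast (by linarith : (1-16*s:ℝ) ≠ 0)
    rw [Complex.ofReal_div, ← mul_assoc, ← mul_assoc, div_mul_cancel₀ _ this]
  · have e : ‖1 - A (16*s)‖ = ‖ζ - PP ζ0 e0 (16*s) h‖ := by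
      rw [hA, ← mul_one ‖1 - A (16*s)‖, ← hζ1, ← norm_smul, sub_smul, one_smul]
    rw [e]
    have d1 := PP_dist hζ0 (e0 := e0) hR h1 (t := 16*s) (by positivity) (by linarith) hh2
    have d2 : ‖ζ - z0‖ ≤ τ/16 := by simpa [dist_eq_norm] using hζ.2.2.2
    have d3 : ‖ζ0 - z0‖ ≤ τ/16 := by simpa [dist_eq_norm] using hP.2.2.2
    have e2 : ζ - PP ζ0 e0 (16*s) h = (ζ - z0) - (ζ0 - z0) - (PP ζ0 e0 (16*s) h - ζ0) := by abel
    rw [e2]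
    have d4 := norm_sub_le ((ζ - z0) - (ζ0 - z0)) (PP ζ0 e0 (16*s) h - ζ0)
    have d5 := norm_sub_le (ζ - z0) (ζ0 - z0)
    linarith
  · rw [← hA]
    have hlt : ∀ z ∈ ball (0:ℂ) 1, ‖PP ζ0 e0 (16*s) ((2*R:ℝ) * z)‖ < 1 ∧ ‖((2*R:ℝ):ℂ) * z‖ ≤ 2*R := by
      intro z hz
      have hz1 : ‖z‖ < 1 := by simpa using hz
      have : ‖((2*R:ℝ):ℂ) * z‖ ≤ 2*R := by
        rw [norm_mul, Complex.norm_real, Real.norm_of_nonneg (by positivity)]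
        exact mul_le_of_le_one_right (by positivity) hz1.le
      exact ⟨PP_lt_one hζ0 hR h1 hβ (by rw [← hs]; linarith) (by rw [← hs]) (by linarith) this, this⟩
    have hk := (harnack0 (f := fun z : ℂ => fF μ (PP ζ0 e0 (16*s) ((2*R:ℝ) * z))) (by
        intro z hz
        obtain ⟨p1, p2⟩ := hlt z hz
        refine DifferentiableAt.differentiableWithinAt ?_
        have q1 := fF_differentiableAt μ hsupp p1
        have q2 := PP_diff (ζ0 := ζ0) (e0 := e0) (t := 16*s) h1 p2
        have q3 : DifferentiableAt ℂ (fun z : ℂ => ((2*R:ℝ):ℂ) * z) z := by fun_prop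
        exact DifferentiableAt.comp z (g := fF μ) (f := fun z : ℂ => PP ζ0 e0 (16*s) ((2*R:ℝ) * z)) q1
          (DifferentiableAt.comp z (g := PP ζ0 e0 (16*s)) (f := fun z : ℂ => ((2*R:ℝ):ℂ) * z) q2 q3))
      (fun z hz => u_nonneg hn μ hsupp hpl (hlt z hz).1) (z := h / ((2*R:ℝ):ℂ)) (by
        rw [mem_ball, dist_zero_right, norm_div, Complex.norm_real, Real.norm_of_nonneg (by positivity),
          div_lt_one (by positivity)]
        linarith)).2
    have hR2 : ((2*R:ℝ):ℂ) ≠ 0 := by exact_mod_cast (by positivity : (2*R:ℝ) ≠ 0)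
    simp only [mul_zero] at hk
    rw [mul_div_cancel₀ _ hR2, PP_zero, norm_div, Complex.norm_real, Real.norm_of_nonneg (by positivity)] at hk
    have hx : ‖h‖/(2*R) ≤ 1/2 := by rw [div_le_iff₀ (by positivity)]; linarith
    have hx0 : 0 ≤ ‖h‖/(2*R) := by positivity
    set x := ‖h‖/(2*R)
    have hu0 : c * (2 - 16*s) ≤ (fF μ (((1 - 16*s : ℝ) : ℂ) • ζ0)).re * (16*s) :=
      le_phi (by linarith) (hP.2.1 (16*s) (by linarith) (by linarith))
    have hun : 0 ≤ (fF μ (PP ζ0 e0 (16*s) h)).re := by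
      refine u_nonneg hn μ hsupp hpl (PP_lt_one hζ0 hR h1 hβ (by rw [← hs]; linarith) (by rw [← hs]) (by linarith) (by linarith))
    set U0 := (fF μ (((1 - 16*s : ℝ) : ℂ) • ζ0)).re
    set U := (fF μ (PP ζ0 e0 (16*s) h)).re
    have hU0 : 0 ≤ U0 := by
      have : 0 < U0 * (16*s) := lt_of_lt_of_le (mul_pos hc (by linarith)) hu0
      exact (pos_of_mul_pos_left this (by positivity)).le
    have hk2 : U0 * (1/2) ≤ U * (3/2) := by
      calc _ ≤ U0 * (1 - x) := by gcongr; linarith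
        _ ≤ _ := hk
        _ ≤ _ := by gcongr; linarith
    have hk3 := mul_le_mul_of_nonneg_right hk2 (show 0 ≤ 32 * s by positivity)
    have hk4 := mul_le_mul_of_nonneg_left (show 3/2 ≤ 2 - 16*s by linarith) hc.le
    linarith

/-- the bad set has definite density -/
lemma key_density {c τ R : ℝ} {z0 ζ0 e0 : EuclideanSpace ℂ (Fin n)} (hc : 0 < c) (hτ : 0 < τ) (hτ1 : τ ≤ 1)
    (hP : ζ0 ∈ Piece μ c τ z0) {s : ℝ} (hs : s = ‖e0 - (inner ℂ ζ0 e0 : ℂ) • ζ0‖^2 * R^2)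
    (hβ : 0 < ‖e0 - (inner ℂ ζ0 e0 : ℂ) • ζ0‖) (hR : 0 < R)
    (h1 : ‖(inner ℂ ζ0 e0 : ℂ)‖ * (2*R) ≤ 1/4) (hsL : 400000 * s ≤ 1/100) (hsτ : 400000 * s ≤ τ)
    (h3 : 16 * s + 2 * R * ‖e0 - (inner ℂ ζ0 e0 : ℂ) • ζ0‖ ≤ τ/8)
    {B : Set ℂ} (hB : MeasurableSet B)
    (hgood : ∀ h, h ∉ B → ∃ l : ℂ, ∃ ζ ∈ Piece μ c τ z0, ζ0 + h • e0 = l • ζ)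
    (hvol : volume (B ∩ closedBall 0 R) ≤ ENNReal.ofReal ((1/(400*400000)) * Real.pi * R^2 / 4)) : False := by
  have hζ0 : ‖ζ0‖ = 1 := by simpa [unitSphere] using hP.1
  have hs0 : 0 < s := by rw [hs]; positivity
  have hlt : ∀ h : ℂ, ‖h‖ < 2 * R → ‖PP ζ0 e0 (400000*s) h‖ < 1 := fun h hh =>
    PP_lt_one hζ0 hR h1 hβ (by rw [← hs]; linarith) (by rw [← hs]; linarith) (by linarith) hh.le
  have hM0 : 0 < c * ((2 - 400000*s)/(400000*s)) := by
    have : 0 < 2 - 400000*s := by linarith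
    positivity
  have hm := mean_lower (G := fun h => fF μ (PP ζ0 e0 (400000*s) h)) hR (by
      intro h hh
      have hh' : ‖h‖ < 2*R := by simpa using hh
      refine DifferentiableAt.differentiableWithinAt ?_
      exact DifferentiableAt.comp h (g := fF μ) (f := PP ζ0 e0 (400000*s))
        (fF_differentiableAt μ hsupp (hlt h hh')) (PP_diff h1 hh'.le))
    (fun h hh => u_nonneg hn μ hsupp hpl (hlt h hh)) hB
    (m := c * ((2 - 400000*s)/(400000*s)) * (1 + 1/(80*400000))) (by norm_num) (by positivity) hvol (by
      intro h hh a1 a2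
      obtain ⟨l, ζ, hζ, hl⟩ := hgood h hh
      exact good_lower hn μ hsupp hpl hc hτ hτ1 hP hs hβ hR h1 hsL h3 a1 a2 hζ hl)
  simp only [PP_zero] at hm
  have h5 := phi_le (by linarith) ((phi_mono hn μ hsupp hpl hζ0 (show 0 < 400000*s by positivity) hsτ hτ1).trans hP.2.2.1)
  have h6 : (fF μ (((1 - 400000*s : ℝ) : ℂ) • ζ0)).re ≤ c * ((2 - 400000*s)/(400000*s)) * (1 + 1/(400*400000)) := by
    rw [← le_div_iff₀ (by positivity)] at h5
    refine h5.trans (le_of_eq ?_)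
    field_simp
  have h7 := hm.trans h6
  set M := c * ((2 - 400000*s)/(400000*s))
  norm_num at h7
  linarith
end

end G3part

noncomputable section G4part
section
variable {n : ℕ} (hn : 2 ≤ n) (μ : Measure (EuclideanSpace ℂ (Fin n))) [IsFiniteMeasure μ]
    (hsupp : μ (unitSphere n)ᶜ = 0) (hpl : Pluri μ)

include hsupp in
lemma piece_compact {c τ : ℝ} (hτ : 0 < τ) (hτ1 : τ ≤ 1) (z0 : EuclideanSpace ℂ (Fin n)) :
    IsCompact (Piece μ c τ z0) := by
  have hS : IsClosed (unitSphere n) := isClosed_sphere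
  have e : Piece μ c τ z0 = ((⋂ r : Ioo (0:ℝ) 1, unitSphere n ∩ (fun ζ => phi μ ζ r) ⁻¹' (Ici c)) ∩
      (unitSphere n ∩ (fun ζ => phi μ ζ τ) ⁻¹' (Iic (c * (1 + 1/(400*400000)))))) ∩ closedBall z0 (τ/16) := by
    ext ζ
    constructor
    · rintro ⟨h1, h2, h3, h4⟩
      exact ⟨⟨mem_iInter.2 fun r => ⟨h1, h2 r r.2.1 r.2.2⟩, h1, h3⟩, h4⟩
    · rintro ⟨⟨h1, h2, h3⟩, h4⟩
      exact ⟨h2, fun r r0 r1 => (mem_iInter.1 h1 ⟨r, r0, r1⟩).2, h3, h4⟩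
  rw [e]
  refine (isCompact_closedBall z0 (τ/16)).inter_left ?_
  refine IsClosed.inter (isClosed_iInter fun r => ?_) ?_
  · exact (phi_contOn μ hsupp r.2.1 r.2.2.le).preimage_isClosed_of_isClosed hS isClosed_Ici
  · exact (phi_contOn μ hsupp hτ hτ1).preimage_isClosed_of_isClosed hS isClosed_Iic

def coneOf (K : Set (EuclideanSpace ℂ (Fin n))) : Set (EuclideanSpace ℂ (Fin n)) :=
  {z | ∃ l : ℂ, l ≠ 0 ∧ ∃ ζ ∈ K, z = l • ζ}

lemma cone_meas {K : Set (EuclideanSpace ℂ (Fin n))} (hK : IsCompact K) : MeasurableSet (coneOf K) := by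
  have e : coneOf K = ⋃ k : ℕ, (fun p : ℂ × EuclideanSpace ℂ (Fin n) => p.1 • p.2) ''
      ((closedBall (0:ℂ) ((k:ℝ)+1) ∩ {l | 1/((k:ℝ)+1) ≤ ‖l‖}) ×ˢ K) := by
    ext z
    rw [mem_iUnion]
    constructor
    · rintro ⟨l, hl, ζ, hζ, rfl⟩
      obtain ⟨k1, hk1⟩ := exists_nat_one_div_lt (norm_pos_iff.2 hl)
      obtain ⟨k2, hk2⟩ := exists_nat_gt ‖l‖
      refine ⟨max k1 k2, (l, ζ), ⟨⟨?_, ?_⟩, hζ⟩, rfl⟩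
      · rw [mem_closedBall, dist_zero_right]
        have : (k2:ℝ) ≤ (max k1 k2 : ℕ) := by exact_mod_cast le_max_right _ _
        simp only; linarith
      · refine le_trans ?_ hk1.le
        have : (k1:ℝ) ≤ (max k1 k2 : ℕ) := by exact_mod_cast le_max_left _ _
        gcongr
    · rintro ⟨k, ⟨l, ζ⟩, ⟨⟨_, h2⟩, h3⟩, rfl⟩
      refine ⟨l, ?_, ζ, h3, rfl⟩
      rw [← norm_pos_iff]
      have h2' : 1/((k:ℝ)+1) ≤ ‖l‖ := h2
      exact lt_of_lt_of_le (by positivity) h2'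
  rw [e]
  refine MeasurableSet.iUnion fun k => ?_
  refine IsCompact.measurableSet (IsCompact.image (IsCompact.prod ?_ hK) continuous_smul)
  exact (isCompact_closedBall _ _).inter_right (isClosed_le continuous_const continuous_norm)

include hn hsupp hpl

lemma piece_null {c τ : ℝ} (hc : 0 < c) (hτ : 0 < τ) (hτ1 : τ ≤ 1) (z0 : EuclideanSpace ℂ (Fin n)) :
    μ (Piece μ c τ z0) = 0 := by
  have hT := cone_meas (piece_compact μ hsupp (c := c) hτ hτ1 z0)
  have hsub : Piece μ c τ z0 ⊆ coneOf (Piece μ c τ z0) := fun ζ hζ => ⟨1, one_ne_zero, ζ, hζ, by simp⟩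
  refine measure_mono_null hsub (lemD2 hn μ hsupp hpl hT ?_ ?_)
  · rintro z ⟨l, hl, ζ, hζ, rfl⟩ l' hl'
    exact ⟨l' * l, mul_ne_zero hl' hl, ζ, hζ, by rw [smul_smul]⟩
  let e : EuclideanSpace ℂ (Fin n) := EuclideanSpace.single ⟨0, by omega⟩ 1
  have he : e ≠ 0 := by
    rw [← norm_pos_iff]; simp [e]
  refine lemD3 hn hT e ?_
  intro y hy
  set A : Set ℂ := {x : ℂ | y + x • e ∈ coneOf (Piece μ c τ z0)} with hAdef
  have hAm : MeasurableSet A := by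
    have : Measurable (fun x : ℂ => y + x • e) := Continuous.measurable (by fun_prop)
    exact this hT
  have hae := Besicovitch.ae_tendsto_measure_inter_div_of_measurableSet (volume : Measure ℂ) hAm.compl
  rw [ae_iff] at hae
  refine measure_mono_null ?_ hae
  intro x0 hx0
  simp only [mem_setOf_eq]
  intro htend
  have hx0c : x0 ∉ Aᶜ := fun h => h hx0
  rw [indicator_of_notMem hx0c] at htend
  obtain ⟨l0, hl0, ζ0, hζ0P, hl0e⟩ := hx0
  have hζ0 : ‖ζ0‖ = 1 := by simpa [unitSphere] using hζ0P.1
  set e0 := l0⁻¹ • e with he0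
  have hβ : 0 < ‖e0 - (inner ℂ ζ0 e0 : ℂ) • ζ0‖ := by
    rw [norm_pos_iff]
    intro h
    set α : ℂ := inner ℂ ζ0 e0
    have h1 : e0 = α • ζ0 := sub_eq_zero.1 h
    have h2 : e = α • (y + x0 • e) := by
      rw [hl0e, smul_comm, ← h1, he0, smul_smul, mul_inv_cancel₀ hl0, one_smul]
    have hα : α ≠ 0 := by
      intro h3; rw [h3, zero_smul] at h2; exact he h2
    apply hy
    have h3 : y = (α⁻¹ - x0) • e := by
      have h4 : α⁻¹ • e = y + x0 • e := by
        conv_lhs => rw [h2]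
        rw [smul_smul, inv_mul_cancel₀ hα, one_smul]
      rw [sub_smul, h4]; abel
    rw [h3]
    exact Submodule.smul_mem _ _ (Submodule.mem_span_singleton_self e)
  set b := ‖e0 - (inner ℂ ζ0 e0 : ℂ) • ζ0‖ with hb
  have ev : ∀ (g : ℝ → ℝ), Continuous g → ∀ a, g 0 < a → ∀ᶠ R in 𝓝[>] (0:ℝ), g R ≤ a := by
    intro g hg a ha
    have : ∀ᶠ R in 𝓝 (0:ℝ), g R < a := hg.continuousAt.eventually_lt continuousAt_const ha
    filter_upwards [nhdsWithin_le_nhds this] with R hR using hR.le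
  have v1 := ev (fun R => ‖(inner ℂ ζ0 e0 : ℂ)‖ * (2*R)) (by fun_prop) (1/4) (by norm_num)
  have v2 := ev (fun R => 400000 * (b^2 * R^2)) (by fun_prop) (1/100) (by norm_num)
  have v3 := ev (fun R => 400000 * (b^2 * R^2)) (by fun_prop) τ (by simpa using hτ)
  have v4 := ev (fun R => 16 * (b^2 * R^2) + 2 * R * b) (by fun_prop) (τ/8) (by simpa using hτ)
  have hω : (0:ℝ≥0∞) < ENNReal.ofReal (1/(400*400000)/4) := by
    rw [ENNReal.ofReal_pos]; norm_num
  have v5 := htend.eventually_lt_const hω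
  have v0 : ∀ᶠ R in 𝓝[>] (0:ℝ), 0 < R := self_mem_nhdsWithin
  obtain ⟨R, hR, w1, w2, w3, w4, w5⟩ := (v0.and
    (v1.and (v2.and (v3.and (v4.and v5))))).exists
  have hR0 : 0 < R := hR
  let B : Set ℂ := {h | x0 + h ∉ A}
  have hBm : MeasurableSet B := (measurable_const_add x0) hAm.compl
  refine key_density hn μ hsupp hpl hc hτ hτ1 hζ0P (s := b^2*R^2) rfl hβ hR0 w1 w2 w3 w4 (B := B) hBm ?_ ?_
  · intro h hh
    have hh' : x0 + h ∈ A := not_not.1 hh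
    obtain ⟨l, hl, ζ, hζ, hle⟩ := hh'
    refine ⟨l0⁻¹ * l, ζ, hζ, ?_⟩
    have e1 : y + (x0 + h) • e = l0 • ζ0 + h • e := by rw [← hl0e]; module
    rw [e1] at hle
    rw [mul_smul, ← hle, smul_add, inv_smul_smul₀ hl0, he0, smul_comm]
  · have e1 : B ∩ closedBall 0 R = (fun h => x0 + h) ⁻¹' (Aᶜ ∩ closedBall x0 R) := by
      ext h
      simp [B, dist_eq_norm]
    rw [e1, measure_preimage_add]
    have hv : volume (closedBall x0 R) = ENNReal.ofReal (Real.pi * R^2) := by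
      rw [Complex.volume_closedBall, mul_comm Real.pi, ENNReal.ofReal_mul (by positivity),
        ENNReal.ofReal_pow hR0.le]
      congr 1
      exact (ENNReal.ofReal_coe_nnreal (p := NNReal.pi)).symm
    have hv0 : volume (closedBall x0 R) ≠ 0 := (measure_closedBall_pos volume _ hR0).ne'
    have hvt : volume (closedBall x0 R) ≠ ⊤ := by rw [hv]; exact ENNReal.ofReal_ne_top
    have w6 := (ENNReal.div_le_iff hv0 hvt).1 w5.le
    refine w6.trans (le_of_eq ?_)
    rw [hv, ← ENNReal.ofReal_mul (by norm_num)]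
    congr 1; ring

theorem final_thm {E : Set (EuclideanSpace ℂ (Fin n))} (hEs : E ⊆ unitSphere n)
    (hE : MeasurableSet E) (hfin : μH[2 * (n : ℝ) - 2] E < ⊤) : μ E = 0 := by
  have hz := zero_part hn μ hsupp hpl hEs hE hfin
  let zs := TopologicalSpace.denseSeq (EuclideanSpace ℂ (Fin n))
  have hp : μ (⋃ (c : {c : ℚ // 0 < c}) (k : ℕ) (i : ℕ), Piece μ ((c:ℚ):ℝ) (1/((k:ℝ)+1)) (zs i)) = 0 := by
    refine measure_iUnion_null fun c => measure_iUnion_null fun k => measure_iUnion_null fun i => ?_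
    refine piece_null hn μ hsupp hpl (by exact_mod_cast c.2) (by positivity) ?_ _
    rw [div_le_one (by positivity)]
    have : (0:ℝ) ≤ k := by positivity
    linarith
  refine measure_mono_null ?_ (measure_union_null hz hp)
  intro ζ hζ
  have hζ1 : ‖ζ‖ = 1 := by simpa [unitSphere] using hEs hζ
  by_cases h : ∀ c > 0, ∃ τ, 0 < τ ∧ τ ≤ 1 ∧ phi μ ζ τ < c
  · exact Or.inl ⟨hζ, h⟩
  right
  push Not at h
  obtain ⟨c0, hc0, hc0l⟩ := h
  let I : Set ℝ := (fun τ => phi μ ζ τ) '' Ioc 0 1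
  have hne : I.Nonempty := ⟨_, 1, ⟨one_pos, le_rfl⟩, rfl⟩
  have hbd : BddBelow I := ⟨c0, by rintro _ ⟨τ, hτ, rfl⟩; exact hc0l τ hτ.1 hτ.2⟩
  set a := sInf I with ha
  have ha0 : 0 < a := lt_of_lt_of_le hc0 (le_csInf hne (by rintro _ ⟨τ, hτ, rfl⟩; exact hc0l τ hτ.1 hτ.2))
  obtain ⟨q, hq1, hq2⟩ := exists_rat_btwn (show a / (1 + 1/(400*400000)) < a by
    rw [div_lt_iff₀ (by norm_num)]; linarith)
  have hq0 : (0:ℝ) < q := lt_trans (by positivity) hq1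
  rw [div_lt_iff₀ (by norm_num)] at hq1
  obtain ⟨_, ⟨τ, hτ, rfl⟩, hτ2⟩ := exists_lt_of_csInf_lt hne hq1
  simp only at hτ2
  obtain ⟨k, hk⟩ := exists_nat_one_div_lt hτ.1
  obtain ⟨i, hi⟩ := Metric.denseRange_iff.1 (TopologicalSpace.denseRange_denseSeq (EuclideanSpace ℂ (Fin n))) ζ
    (1/((k:ℝ)+1)/16) (by positivity)
  simp only [mem_iUnion]
  refine ⟨⟨q, by exact_mod_cast hq0⟩, k, i, hEs hζ, ?_, ?_, ?_⟩
  · intro r h0 h1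
    exact hq2.le.trans (csInf_le hbd ⟨r, ⟨h0, h1.le⟩, rfl⟩)
  · exact (phi_mono hn μ hsupp hpl hζ1 (by positivity) hk.le hτ.2).trans hτ2.le
  · exact hi.le
end

end G4part

/-- a positive pluriharmonic measure on `S^{2n−1}` vanishes on every
Borel set of finite `(2n−2)`-dimensional Hausdorff measure. -/
theorem stmt11 {n : ℕ} (hn : 2 ≤ n)
    (μ : Measure (EuclideanSpace ℂ (Fin n))) [IsFiniteMeasure μ]
    (hsupp : μ (unitSphere n)ᶜ = 0)
    (hpluri : ∀ p q : ℕ, 1 ≤ p → 1 ≤ q →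
      ∀ P : EuclideanSpace ℂ (Fin n) → ℂ, MemHpq n p q P →
        ∫ z, (starRingEnd ℂ) (P z) ∂μ = 0)
    (E : Set (EuclideanSpace ℂ (Fin n))) (hEs : E ⊆ unitSphere n)
    (hE : MeasurableSet E) (hfin : μH[2 * (n : ℝ) - 2] E < ⊤) :
    μ E = 0 := by
  exact final_thm hn μ hsupp hpluri hEs hE hfin
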